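/- Let H be a tree of Eulerian graphs such that the number of negative non-bridge edges of H is even. Then H admits a weak signed circuit cover of length at most (4/3)·|E(H)|. -/

import Mathlib

open Finset
open scoped Classical

noncomputable section

namespace SignedCircuitCover

variable {V E : Type} [Fintype V] [Fintype E] [DecidableEq V] [DecidableEq E]

/-- `e` is a loop. -/
def IsLoop (ends : E → Sym2 V) (e : E) : Prop := (ends e).IsDiag

/-- The vertices incident with an edge of `F`. -/
def support (ends : E → Sym2 V) (F : Finset E) : Finset V :=
  Finset.univ.filter fun v => ∃ e ∈ F, v ∈ ends e

/-- Degree of `v` in the subgraph with edge set `F` (a loop counts twice). -/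
def degree (ends : E → Sym2 V) (F : Finset E) (v : V) : ℕ :=
  ∑ e ∈ F, (if ends e = Sym2.diag v then 2 else if v ∈ ends e then 1 else 0)

/-- Reachability inside the edge set `F`. -/
def Reach (ends : E → Sym2 V) (F : Finset E) : V → V → Prop :=
  Relation.ReflTransGen fun a b => ∃ e ∈ F, ends e = s(a, b)

/-- The subgraph with edge set `F` is connected. -/
def ConnectedOn (ends : E → Sym2 V) (F : Finset E) : Prop :=
  ∀ u ∈ support ends F, ∀ v ∈ support ends F, Reach ends F u v

/-- The whole graph is connected. -/
def Connected (ends : E → Sym2 V) : Prop :=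
  ∀ u v : V, Reach ends (Finset.univ : Finset E) u v

/-- `F` is the edge set of a circuit (connected, 2-regular; a loop is a circuit). -/
def IsCircuit (ends : E → Sym2 V) (F : Finset E) : Prop :=
  F.Nonempty ∧ ConnectedOn ends F ∧ ∀ v ∈ support ends F, degree ends F v = 2

/-- `F` is the edge set of an Eulerian subgraph (connected, all degrees even). -/
def IsEulerianOn (ends : E → Sym2 V) (F : Finset E) : Prop :=
  ConnectedOn ends F ∧ ∀ v ∈ support ends F, Even (degree ends F v)

/-- Negative edges of `F` (`sgn e = true` means `e` is negative). -/
def negEdges (sgn : E → Bool) (F : Finset E) : Finset E := F.filter fun e => sgn e = true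

def IsBalancedCircuit (ends : E → Sym2 V) (sgn : E → Bool) (F : Finset E) : Prop :=
  IsCircuit ends F ∧ Even (negEdges sgn F).card

def IsUnbalancedCircuit (ends : E → Sym2 V) (sgn : E → Bool) (F : Finset E) : Prop :=
  IsCircuit ends F ∧ Odd (negEdges sgn F).card

/-- `P` is the edge set of a path with (distinct) end-vertices `u` and `v`. -/
def IsPath (ends : E → Sym2 V) (P : Finset E) (u v : V) : Prop :=
  P.Nonempty ∧ ConnectedOn ends P ∧ u ≠ v ∧
    u ∈ support ends P ∧ v ∈ support ends P ∧
    degree ends P u = 1 ∧ degree ends P v = 1 ∧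
    ∀ w ∈ support ends P, w ≠ u → w ≠ v → degree ends P w = 2

/-- A short barbell: two unbalanced circuits meeting at exactly one vertex. -/
def IsShortBarbell (ends : E → Sym2 V) (sgn : E → Bool) (F : Finset E) : Prop :=
  ∃ C₁ C₂ : Finset E, Disjoint C₁ C₂ ∧ F = C₁ ∪ C₂ ∧
    IsUnbalancedCircuit ends sgn C₁ ∧ IsUnbalancedCircuit ends sgn C₂ ∧
    ∃ v : V, support ends C₁ ∩ support ends C₂ = {v}

/-- A long barbell: two disjoint unbalanced circuits joined by a path meeting
them only at its end-vertices. -/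
def IsLongBarbell (ends : E → Sym2 V) (sgn : E → Bool) (F : Finset E) : Prop :=
  ∃ (C₁ C₂ P : Finset E) (u v : V),
    Disjoint C₁ C₂ ∧ Disjoint C₁ P ∧ Disjoint C₂ P ∧ F = C₁ ∪ C₂ ∪ P ∧
    IsUnbalancedCircuit ends sgn C₁ ∧ IsUnbalancedCircuit ends sgn C₂ ∧
    Disjoint (support ends C₁) (support ends C₂) ∧
    IsPath ends P u v ∧
    support ends P ∩ support ends C₁ = {u} ∧
    support ends P ∩ support ends C₂ = {v}

def IsBarbell (ends : E → Sym2 V) (sgn : E → Bool) (F : Finset E) : Prop :=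
  IsShortBarbell ends sgn F ∨ IsLongBarbell ends sgn F

/-- A signed circuit: a balanced circuit, a short barbell or a long barbell. -/
def IsSignedCircuit (ends : E → Sym2 V) (sgn : E → Bool) (F : Finset E) : Prop :=
  IsBalancedCircuit ends sgn F ∨ IsShortBarbell ends sgn F ∨ IsLongBarbell ends sgn F

/-- `e` is a bridge (cut-edge) of the subgraph with edge set `F`. -/
def IsBridgeIn (ends : E → Sym2 V) (F : Finset E) (e : E) : Prop :=
  e ∈ F ∧ ∀ a b : V, ends e = s(a, b) → ¬ Reach ends (F.erase e) a b

/-- The bridges of the whole graph. -/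
def bridges (ends : E → Sym2 V) : Finset E :=
  Finset.univ.filter fun e => IsBridgeIn ends Finset.univ e

/-- The non-bridge edges of the whole graph. -/
def nonbridges (ends : E → Sym2 V) : Finset E := Finset.univ \ bridges ends

/-- Reachability inside `F` avoiding the vertex `x`. -/
def ReachAvoid (ends : E → Sym2 V) (F : Finset E) (x : V) : V → V → Prop :=
  Relation.ReflTransGen fun a b => a ≠ x ∧ b ≠ x ∧ ∃ e ∈ F, ends e = s(a, b)

/-- `x` is a cut-vertex of the subgraph with edge set `F`. -/
def IsCutVertexOn (ends : E → Sym2 V) (F : Finset E) (x : V) : Prop :=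
  ∃ a ∈ support ends F, ∃ b ∈ support ends F,
    a ≠ x ∧ b ≠ x ∧ Reach ends F a b ∧ ¬ ReachAvoid ends F x a b

/-- The subgraph with edge set `F` is 2-connected (connected and without cut-vertices). -/
def TwoConnectedOn (ends : E → Sym2 V) (F : Finset E) : Prop :=
  ConnectedOn ends F ∧ ∀ x : V, ¬ IsCutVertexOn ends F x

/-- The whole graph is 2-connected. -/
def TwoConnected (ends : E → Sym2 V) : Prop :=
  Connected ends ∧ ∀ x : V, ¬ IsCutVertexOn ends (Finset.univ : Finset E) x

/-- Total length of a collection of subgraphs. -/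
def totalLength (𝒞 : List (Finset E)) : ℕ := (𝒞.map Finset.card).sum

/-- The width of the edge `e` with respect to the collection `𝒞`. -/
def widthAt (𝒞 : List (Finset E)) (e : E) : ℕ := (𝒞.filter fun C => e ∈ C).length

/-- `𝒞` covers every edge of the graph. -/
def CoversAll (𝒞 : List (Finset E)) : Prop := ∀ e : E, ∃ C ∈ 𝒞, e ∈ C

/-- A tree of Eulerian graphs: connected, and after deleting all bridges every
component is Eulerian (equivalently all degrees in the bridgeless part are even). -/
def IsTreeOfEulerian (ends : E → Sym2 V) : Prop :=
  Connected ends ∧ ∀ v : V, Even (degree ends (nonbridges ends) v)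

/-- Non-bridge non-loop edges. -/
def nbnl (ends : E → Sym2 V) : Finset E :=
  (nonbridges ends).filter fun e => ¬ IsLoop ends e

/-- A tree of circuits: connected, and after deleting all bridges and loops every
vertex has degree 0 or 2 (each component is an isolated vertex or a circuit). -/
def IsTreeOfCircuits (ends : E → Sym2 V) : Prop :=
  Connected ends ∧
    ∀ v : V, degree ends (nbnl ends) v = 0 ∨ degree ends (nbnl ends) v = 2

/-- The balloon containing `v`: the edge set of the component of `v` in the
graph of non-bridge non-loop edges. -/
def compBalloon (ends : E → Sym2 V) (v : V) : Finset E :=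
  (nbnl ends).filter fun e => ∃ w ∈ ends e, Reach ends (nbnl ends) v w

/-- Valency of the balloon of `v`: the number of bridges and loops incident
with its component. -/
def balloonValency (ends : E → Sym2 V) (v : V) : ℕ :=
  (Finset.univ.filter fun e =>
    (IsBridgeIn ends Finset.univ e ∨ IsLoop ends e) ∧
      ∃ w ∈ ends e, Reach ends (nbnl ends) v w).card

/-- A balloon consisting of a single negative loop. -/
def IsNegLoopBalloon (ends : E → Sym2 V) (sgn : E → Bool) (B : Finset E) : Prop :=
  ∃ e : E, IsLoop ends e ∧ sgn e = true ∧ B = {e}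

/-- A leaf balloon: a negative loop, or a nontrivial balloon of valency 1. -/
def IsLeafBalloon (ends : E → Sym2 V) (sgn : E → Bool) (B : Finset E) : Prop :=
  IsNegLoopBalloon ends sgn B ∨
    ∃ v : V, B = compBalloon ends v ∧ B.Nonempty ∧ balloonValency ends v = 1

/-- A leaf circuit: a negative loop, or a balloon of valency 1 which is a circuit. -/
def IsLeafCircuit (ends : E → Sym2 V) (sgn : E → Bool) (B : Finset E) : Prop :=
  IsNegLoopBalloon ends sgn B ∨
    ∃ v : V, B = compBalloon ends v ∧ IsCircuit ends B ∧ balloonValency ends v = 1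

/-- An inner circuit: a balloon of valency at least 2 which is a circuit. -/
def IsInnerCircuit (ends : E → Sym2 V) (B : Finset E) : Prop :=
  ∃ v : V, B = compBalloon ends v ∧ IsCircuit ends B ∧ 2 ≤ balloonValency ends v

/-- Number of unbalanced circuits of a tree of circuits: negative loops together
with the unbalanced (nontrivial) balloons. -/
def numUnbalancedCircuits (ends : E → Sym2 V) (sgn : E → Bool) : ℕ :=
  (Finset.univ.filter fun e : E => IsLoop ends e ∧ sgn e = true).card +
    Set.ncard {B : Finset E |
      (∃ v : V, B = compBalloon ends v) ∧ B.Nonempty ∧ Odd (negEdges sgn B).card}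

/-- Flow-admissibility: every edge lies in a signed circuit (Bouchet). -/
def FlowAdmissible (ends : E → Sym2 V) (sgn : E → Bool) : Prop :=
  ∀ e : E, ∃ C : Finset E, IsSignedCircuit ends sgn C ∧ e ∈ C

/-- `e` has exactly one end-vertex in `U`. -/
def crosses (ends : E → Sym2 V) (U : Finset V) (e : E) : Prop :=
  ∃ a b : V, ends e = s(a, b) ∧ ((a ∈ U ∧ b ∉ U) ∨ (a ∉ U ∧ b ∈ U))

/-- Switching the signature at the vertex set `U`. -/
def switch (ends : E → Sym2 V) (U : Finset V) (sgn : E → Bool) : E → Bool :=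
  fun e => if crosses ends U e then ! (sgn e) else sgn e

/-- The number of negative edges of a signature. -/
def negCount (sgn : E → Bool) : ℕ := (Finset.univ.filter fun e => sgn e = true).card

/-- `sgn` is a minimum signature: no equivalent (switched) signature has fewer
negative edges. -/
def IsMinSignature (ends : E → Sym2 V) (sgn : E → Bool) : Prop :=
  ∀ U : Finset V, negCount sgn ≤ negCount (switch ends U sgn)

/-- `{e₁, e₂}` is a 2-edge-cut of the subgraph with edge set `F`. -/
def IsTwoEdgeCut (ends : E → Sym2 V) (F : Finset E) (e₁ e₂ : E) : Prop :=
  e₁ ≠ e₂ ∧ e₁ ∈ F ∧ e₂ ∈ F ∧ ¬ IsBridgeIn ends F e₁ ∧ ¬ IsBridgeIn ends F e₂ ∧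
    (∀ a b : V, ends e₁ = s(a, b) → ¬ Reach ends ((F.erase e₁).erase e₂) a b) ∧
    (∀ a b : V, ends e₂ = s(a, b) → ¬ Reach ends ((F.erase e₁).erase e₂) a b)

/-- `b` is a bridge of `F` whose removal leaves two parts which are both unbalanced. -/
def SeparatesUnbalanced (ends : E → Sym2 V) (sgn : E → Bool) (F : Finset E) (b : E) : Prop :=
  IsBridgeIn ends F b ∧
    ∀ a c : V, ends b = s(a, c) →
      (∃ C ⊆ F.erase b, IsUnbalancedCircuit ends sgn C ∧
        ∃ w ∈ support ends C, Reach ends (F.erase b) a w) ∧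
      (∃ C ⊆ F.erase b, IsUnbalancedCircuit ends sgn C ∧
        ∃ w ∈ support ends C, Reach ends (F.erase b) c w)

/-- `T` is a spanning tree of the whole graph: spanning, connected and acyclic. -/
def IsSpanningTree (ends : E → Sym2 V) (T : Finset E) : Prop :=
  (∀ u v : V, Reach ends T u v) ∧ ∀ C ⊆ T, ¬ IsCircuit ends C


set_option linter.unusedSectionVars false

/-! ### Walks as edge lists -/

def Wk (ends : E → Sym2 V) : V → List E → V → Prop
  | u, [], v => u = v
  | u, e :: L, v => ∃ x, ends e = s(u, x) ∧ Wk ends x L v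

section walks
variable {ends : E → Sym2 V}

theorem wk_nil {u v : V} : Wk ends u [] v ↔ u = v := Iff.rfl

theorem wk_cons {u v : V} {e : E} {L : List E} :
    Wk ends u (e :: L) v ↔ ∃ x, ends e = s(u, x) ∧ Wk ends x L v := Iff.rfl

theorem wk_append {u v : V} {L1 L2 : List E} :
    Wk ends u (L1 ++ L2) v ↔ ∃ x, Wk ends u L1 x ∧ Wk ends x L2 v := by
  induction L1 generalizing u with
  | nil => simp [Wk]
  | cons e L ih =>
    simp only [List.cons_append, wk_cons, ih]
    constructor
    · rintro ⟨x, h, y, h1, h2⟩; exact ⟨y, ⟨x, h, h1⟩, h2⟩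
    · rintro ⟨y, ⟨x, h, h1⟩, h2⟩; exact ⟨x, h, y, h1, h2⟩

theorem Wk.append {u v w : V} {L1 L2 : List E} (h1 : Wk ends u L1 v) (h2 : Wk ends v L2 w) :
    Wk ends u (L1 ++ L2) w := wk_append.2 ⟨v, h1, h2⟩

theorem wk_single {u v : V} {e : E} : Wk ends u [e] v ↔ ends e = s(u, v) := by
  simp [Wk]

theorem Wk.unique {u v w : V} {L : List E} (h1 : Wk ends u L v) (h2 : Wk ends u L w) : v = w := by
  induction L generalizing u with
  | nil => exact h1.symm.trans h2
  | cons e L ih =>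
    obtain ⟨x, hx, h1⟩ := h1
    obtain ⟨y, hy, h2⟩ := h2
    have : x = y := by
      rw [hx] at hy; exact Sym2.congr_right.1 hy
    subst this
    exact ih h1 h2

theorem Wk.rev {u v : V} {L : List E} (h : Wk ends u L v) : Wk ends v L.reverse u := by
  induction L generalizing u with
  | nil => exact h.symm
  | cons e L ih =>
    obtain ⟨x, hx, h1⟩ := h
    rw [List.reverse_cons]
    exact (ih h1).append (wk_single.2 (by rw [hx, Sym2.eq_swap]))

theorem mem_supp {L : List E} {y : V} : y ∈ support ends L.toFinset ↔ ∃ e ∈ L, y ∈ ends e := by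
  simp [support]

theorem Wk.touch {u v y : V} {L : List E} (h : Wk ends u L v)
    (hy : y ∈ support ends L.toFinset) :
    ∃ L1 L2, L = L1 ++ L2 ∧ Wk ends u L1 y ∧ Wk ends y L2 v := by
  obtain ⟨e, he, hye⟩ := mem_supp.1 hy
  obtain ⟨s, t, rfl⟩ := List.append_of_mem he
  obtain ⟨a, h1, b, hab, h2⟩ := wk_append.1 h
  rw [hab, Sym2.mem_iff] at hye
  rcases hye with rfl | rfl
  · exact ⟨s, e :: t, rfl, h1, _, hab, h2⟩
  · exact ⟨s ++ [e], t, by simp, h1.append (wk_single.2 hab), h2⟩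

theorem Wk.start_mem {u v : V} {L : List E} (h : Wk ends u L v) (hL : L ≠ []) :
    u ∈ support ends L.toFinset := by
  cases L with
  | nil => exact absurd rfl hL
  | cons e L =>
    obtain ⟨x, hx, -⟩ := h
    exact mem_supp.2 ⟨e, by simp, by simp [hx]⟩

theorem Wk.end_mem {u v : V} {L : List E} (h : Wk ends u L v) (hL : L ≠ []) :
    v ∈ support ends L.toFinset := by
  have := h.rev.start_mem (by simpa using hL)
  rw [mem_supp] at this ⊢
  simpa using this

theorem supp_append {L1 L2 : List E} {y : V} :
    y ∈ support ends (L1 ++ L2).toFinset ↔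
      y ∈ support ends L1.toFinset ∨ y ∈ support ends L2.toFinset := by
  simp only [mem_supp, List.mem_append, or_and_right, exists_or]

theorem Wk.mid_mem {u v y : V} {L1 L2 : List E} (h1 : Wk ends u L1 y) (h2 : Wk ends y L2 v)
    (hL : L1 ++ L2 ≠ []) : y ∈ support ends (L1 ++ L2).toFinset := by
  rw [supp_append]
  by_cases h : L1 = []
  · right; exact h2.start_mem (by rintro rfl; simp [h] at hL)
  · left; exact h1.end_mem h

theorem Wk.reach {u v : V} {L : List E} {F : Finset E} (h : Wk ends u L v)
    (hF : ∀ e ∈ L, e ∈ F) : Reach ends F u v := by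
  induction L generalizing u with
  | nil => rw [wk_nil.1 h]; exact Relation.ReflTransGen.refl
  | cons e L ih =>
    obtain ⟨x, hx, h1⟩ := h
    exact Relation.ReflTransGen.head ⟨e, hF e (by simp), hx⟩
      (ih h1 fun f hf => hF f (by simp [hf]))

theorem reach_symm {F : Finset E} {u v : V} (h : Reach ends F u v) : Reach ends F v u := by
  induction h with
  | refl => exact Relation.ReflTransGen.refl
  | tail _ h ih =>
    obtain ⟨e, he, h⟩ := h
    exact Relation.ReflTransGen.head ⟨e, he, by rw [h, Sym2.eq_swap]⟩ ih

theorem Wk.connectedOn {u v : V} {L : List E} (h : Wk ends u L v) :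
    ConnectedOn ends L.toFinset := by
  have key : ∀ y ∈ support ends L.toFinset, Reach ends L.toFinset u y := by
    intro y hy
    obtain ⟨L1, L2, rfl, h1, h2⟩ := h.touch hy
    exact h1.reach (by simp +contextual)
  intro a ha b hb
  exact (reach_symm (key a ha)).trans (key b hb)

/-- contribution -/
def ct (ends : E → Sym2 V) (e : E) (v : V) : ℕ :=
  if ends e = Sym2.diag v then 2 else if v ∈ ends e then 1 else 0

theorem degree_eq (F : Finset E) (v : V) : degree ends F v = ∑ e ∈ F, ct ends e v := by
  unfold degree ct; congr

theorem ct_ne {e : E} {a b : V} (h : ends e = s(a, b)) (hab : a ≠ b) (w : V) :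
    ct ends e w = if w = a ∨ w = b then 1 else 0 := by
  unfold ct
  have : ¬ ends e = Sym2.diag w := by
    rw [h]; intro h'
    have : s(a, b) = s(w, w) := h'
    simp only [Sym2.eq_iff] at this
    rcases this with ⟨rfl, rfl⟩ | ⟨rfl, rfl⟩ <;> exact hab rfl
  rw [if_neg this, h]
  simp [Sym2.mem_iff]

theorem ct_loop {e : E} {a : V} (h : ends e = s(a, a)) (w : V) :
    ct ends e w = if w = a then 2 else 0 := by
  unfold ct
  by_cases hw : w = a
  · subst hw; rw [if_pos (by rw [h]; rfl)]; simp
  · have : ¬ ends e = Sym2.diag w := by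
      rw [h]; intro h'
      have : s(a, a) = s(w, w) := h'
      simp only [Sym2.eq_iff] at this
      exact hw (by tauto)
    rw [if_neg this, h]
    simp [Sym2.mem_iff, hw]

theorem degree_cons {e : E} {L : List E} (he : e ∉ L) (v : V) :
    degree ends (e :: L).toFinset v = ct ends e v + degree ends L.toFinset v := by
  rw [degree_eq, degree_eq, List.toFinset_cons, Finset.sum_insert (by simpa using he)]

theorem ct_eq_zero {e : E} {v : V} : ct ends e v = 0 ↔ v ∉ ends e := by
  obtain ⟨a, b, hab⟩ : ∃ a b, ends e = s(a, b) := by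
    induction h : ends e using Sym2.ind with | _ a b => exact ⟨a, b, rfl⟩
  by_cases h : a = b
  · subst h; rw [ct_loop hab, hab]; simp
  · rw [ct_ne hab h, hab]; simp

theorem degree_zero {F : Finset E} {v : V} (h : v ∉ support ends F) : degree ends F v = 0 := by
  rw [degree_eq]
  apply Finset.sum_eq_zero
  intro e he
  rw [ct_eq_zero]
  intro hv
  exact h (by simp only [support, Finset.mem_filter, Finset.mem_univ, true_and]; exact ⟨e, he, hv⟩)

/-! ### Simple walks -/

def Smp (ends : E → Sym2 V) (u : V) (L : List E) (v : V) : Prop :=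
  Wk ends u L v ∧ ∀ L1 L2 L3 y, L = L1 ++ L2 ++ L3 → Wk ends u L1 y → Wk ends y L2 y →
    Wk ends y L3 v → L2 = []

theorem Smp.tail {u v x : V} {e : E} {L : List E} (h : Smp ends u (e :: L) v)
    (hx : ends e = s(u, x)) (hL : Wk ends x L v) : Smp ends x L v := by
  refine ⟨hL, fun L1 L2 L3 y hl h1 h2 h3 => ?_⟩
  exact h.2 (e :: L1) L2 L3 y (by simp [hl]) ⟨x, hx, h1⟩ h2 h3

theorem Smp.path {u v : V} {L : List E} (h : Smp ends u L v) (hL : L ≠ []) :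
    u ≠ v ∧ L.Nodup ∧ ∀ w ∈ support ends L.toFinset,
      degree ends L.toFinset w = if w = u ∨ w = v then 1 else 2 := by
  induction L generalizing u with
  | nil => exact absurd rfl hL
  | cons e L ih =>
    obtain ⟨x, hx, h1⟩ := h.1
    have hux : u ≠ x := by
      rintro rfl
      have := h.2 [] [e] L u rfl rfl (wk_single.2 hx) h1
      simp at this
    by_cases hL' : L = []
    · subst hL'
      have : x = v := h1
      subst this
      refine ⟨hux, by simp, fun w hw => ?_⟩
      rw [degree_cons (by simp), ct_ne hx hux]
      have : w = u ∨ w = x := by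
        obtain ⟨f, hf, hwf⟩ := mem_supp.1 hw
        simp only [List.mem_singleton] at hf
        subst hf
        simpa [hx] using hwf
      simp [this, degree]
    · obtain ⟨hxv, hnd, hdeg⟩ := ih (h.tail hx h1) hL'
      have hu : u ∉ support ends L.toFinset := by
        intro hu
        obtain ⟨L1, L2, rfl, h2, h3⟩ := h1.touch hu
        have := h.2 [] (e :: L1) L2 u rfl rfl ⟨x, hx, h2⟩ h3
        simp at this
      have he : e ∉ L := by
        intro he
        exact hu (mem_supp.2 ⟨e, he, by simp [hx]⟩)
      have huv : u ≠ v := by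
        rintro rfl; exact hu (h1.end_mem hL')
      refine ⟨huv, by simp [he, hnd], fun w hw => ?_⟩
      rw [degree_cons he, ct_ne hx hux]
      by_cases hwu : w = u
      · subst hwu; rw [degree_zero hu]; simp
      · have hw' : w ∈ support ends L.toFinset := by
          obtain ⟨f, hf, hwf⟩ := mem_supp.1 hw
          rcases List.mem_cons.1 hf with rfl | hf
          · rw [hx, Sym2.mem_iff] at hwf
            rcases hwf with rfl | rfl
            · exact absurd rfl hwu
            · exact h1.start_mem hL'
          · exact mem_supp.2 ⟨f, hf, hwf⟩
        rw [hdeg w hw']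
        by_cases hwx : w = x
        · subst hwx; simp [hwu, hxv]
        · simp [hwu, hwx]

theorem Smp.isPath {u v : V} {L : List E} (h : Smp ends u L v) (hL : L ≠ []) :
    IsPath ends L.toFinset u v := by
  obtain ⟨h1, h2, h3⟩ := h.path hL
  refine ⟨by simpa using hL, h.1.connectedOn, h1, h.1.start_mem hL, h.1.end_mem hL, ?_, ?_, ?_⟩
  · rw [h3 u (h.1.start_mem hL)]; simp
  · rw [h3 v (h.1.end_mem hL)]; simp
  · intro w hw hu hv; rw [h3 w hw]; simp [hu, hv]

/-! ### Circuits -/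

/-- closed circuit walk -/
def Cyc (ends : E → Sym2 V) (x : V) (C : List E) : Prop :=
  Wk ends x C x ∧ C ≠ [] ∧ C.Nodup ∧ IsCircuit ends C.toFinset

theorem cyc_of_min {x : V} {C : List E} (h : Wk ends x C x) (hC : C ≠ [])
    (hmin : ∀ L1 L2 L3 y, C = L1 ++ L2 ++ L3 → Wk ends x L1 y → Wk ends y L2 y →
      Wk ends y L3 x → L2 = [] ∨ L2.length = C.length) :
    Cyc ends x C ∨ ∃ e, C = [e, e] := by
  cases C with
  | nil => exact absurd rfl hC
  | cons e M =>
    obtain ⟨b, hb, hM⟩ := h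
    have hS : Smp ends b M x := by
      refine ⟨hM, fun L1 L2 L3 y hl h1 h2 h3 => ?_⟩
      rcases hmin (e :: L1) L2 L3 y (by simp [hl]) ⟨b, hb, h1⟩ h2 h3 with h | h
      · exact h
      · subst hl; simp at h; omega
    have hcl : Wk ends x (e :: M) x := ⟨b, hb, hM⟩
    by_cases hM0 : M = []
    · subst hM0
      left
      have : b = x := hM
      subst this
      refine ⟨hcl, hC, by simp, by simp, hcl.connectedOn, fun w hw => ?_⟩
      rw [degree_cons (by simp), ct_loop hb]
      obtain ⟨f, hf, hwf⟩ := mem_supp.1 hw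
      simp only [List.mem_singleton] at hf
      subst hf
      have : w = b := by simpa [hb] using hwf
      simp [this, degree]
    · obtain ⟨hbx, hnd, hdeg⟩ := hS.path hM0
      by_cases he : e ∈ M
      · right
        obtain ⟨s, t, rfl⟩ := List.append_of_mem he
        obtain ⟨a, h1, c, hac, h2⟩ := wk_append.1 hM
        have hh : s(x, b) = s(a, c) := by rw [← hb, hac]
        rcases Sym2.eq_iff.1 hh with ⟨rfl, rfl⟩ | ⟨rfl, rfl⟩
        · have := hS.2 s (e :: t) [] x (by simp) h1 ⟨_, hac, h2⟩ rfl
          simp at this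
        · have h3 := hS.2 [] s (e :: t) b (by simp) rfl h1 ⟨_, hac, h2⟩
          have h4 := hS.2 (s ++ [e]) t [] x (by simp) (h1.append (wk_single.2 hac)) h2 rfl
          subst h3; subst h4; exact ⟨e, rfl⟩
      · left
        refine ⟨hcl, hC, by simp [he, hnd], by simp, hcl.connectedOn, fun w hw => ?_⟩
        rw [degree_cons he, ct_ne hb (Ne.symm hbx)]
        have hw' : w ∈ support ends M.toFinset := by
          obtain ⟨f, hf, hwf⟩ := mem_supp.1 hw
          rcases List.mem_cons.1 hf with rfl | hf
          · rw [hb, Sym2.mem_iff] at hwf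
            rcases hwf with rfl | rfl
            · exact hM.end_mem hM0
            · exact hM.start_mem hM0
          · exact mem_supp.2 ⟨f, hf, hwf⟩
        rw [hdeg w hw']
        by_cases h1 : w = x <;> by_cases h2 : w = b <;> simp [h1, h2]

/-- extraction of a minimal closed subwalk -/
theorem extract {u v : V} {L : List E} (h : Wk ends u L v) (hS : ¬ Smp ends u L v) :
    ∃ L1 L2 L3 y, L = L1 ++ L2 ++ L3 ∧ Wk ends u L1 y ∧ Wk ends y L3 v ∧ Wk ends y L2 y ∧
      L2 ≠ [] ∧ (Cyc ends y L2 ∨ ∃ e, L2 = [e, e]) := by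
  have hex : ∃ n, ∃ L1 L2 L3 y, L = L1 ++ L2 ++ L3 ∧ Wk ends u L1 y ∧ Wk ends y L3 v ∧
      Wk ends y L2 y ∧ L2 ≠ [] ∧ L2.length = n := by
    unfold Smp at hS
    push Not at hS
    obtain ⟨L1, L2, L3, y, a, b, c, d, e⟩ := hS h
    exact ⟨_, L1, L2, L3, y, a, b, d, c, e, rfl⟩
  obtain ⟨L1, L2, L3, y, a, b, c, d, e, f⟩ := Nat.find_spec hex
  refine ⟨L1, L2, L3, y, a, b, c, d, e, cyc_of_min d e ?_⟩
  intro M1 M2 M3 z hl h1 h2 h3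
  by_cases hM : M2 = []
  · exact Or.inl hM
  · right
    have := Nat.find_min' hex ⟨L1 ++ M1, M2, M3 ++ L3, z, by simp [a, hl], b.append h1,
      h3.append c, h2, hM, rfl⟩
    have h4 : M2.length ≤ L2.length := by rw [hl]; simp; omega
    omega

end walks

/-! ### Euler tours -/
section euler
variable {ends : E → Sym2 V}

theorem ct_parity {e : E} {a b : V} (h : ends e = s(a, b)) (w : V) :
    Even (ct ends e w + (if w = a then 1 else 0) + (if w = b then 1 else 0)) := by
  by_cases hab : a = b
  · subst hab; rw [ct_loop h]; split_ifs <;> decide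
  · rw [ct_ne h hab]
    by_cases h1 : w = a <;> by_cases h2 : w = b
    · exact absurd (h1.symm.trans h2) hab
    all_goals simp [h1, h2]
    · rw [if_neg hab]; decide
    · rw [if_neg (Ne.symm hab)]; decide

theorem trail_parity {u v : V} {L : List E} (h : Wk ends u L v) (hnd : L.Nodup) (w : V) :
    Even (degree ends L.toFinset w + (if w = u then 1 else 0) + (if w = v then 1 else 0)) := by
  induction L generalizing u with
  | nil =>
    have : u = v := h
    subst this
    simp only [List.toFinset_nil, degree, Finset.sum_empty, zero_add]
    split_ifs <;> decide
  | cons e L ih =>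
    obtain ⟨x, hx, h1⟩ := h
    rw [List.nodup_cons] at hnd
    have h2 := ih h1 hnd.2
    have h3 := ct_parity hx w
    rw [degree_cons hnd.1]
    have h4 := h2.add h3
    rw [Nat.even_iff] at h4 ⊢
    omega

/-- In a graph with even degrees, given closed nodup `L0` (as an edge list), and an edge outside
starting at `y`, there is a nonempty closed nodup walk at `y` avoiding `L0`. -/
theorem closed_ext (hdeg : ∀ v, Even (degree ends Finset.univ v)) {x : V} {L0 : List E}
    (h0 : Wk ends x L0 x) (hnd0 : L0.Nodup) {e : E} {y : V} (he : e ∉ L0) (hy : y ∈ ends e) :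
    ∃ M, Wk ends y M y ∧ M ≠ [] ∧ (L0 ++ M).Nodup := by
  -- maximal trail from y containing at least one edge
  have hbound : ∀ M : List E, (L0 ++ M).Nodup → M.length ≤ Fintype.card E := by
    intro M hM
    have := hM.length_le_card
    simp at this; omega
  let P : ℕ → Prop := fun n => ∃ M z, Wk ends y M z ∧ M ≠ [] ∧ (L0 ++ M).Nodup ∧ M.length = n
  have hP : ∃ n, P n := by
    obtain ⟨z, hz⟩ := hy
    refine ⟨1, [e], z, wk_single.2 hz, by simp, ?_, rfl⟩
    rw [List.nodup_append]
    exact ⟨hnd0, by simp, by rintro a ha b hb rfl; simp at hb; exact he (hb ▸ ha)⟩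
  obtain ⟨n0, hn0⟩ := hP
  have hle : n0 ≤ Fintype.card E := by
    obtain ⟨M, z, _, _, h3, h4⟩ := hn0
    rw [← h4]; exact hbound M h3
  have hspec := Nat.findGreatest_spec (P := P) hle hn0
  obtain ⟨M, z, h1, h2, h3, h4⟩ := hspec
  by_cases hyz : z = y
  · subst hyz; exact ⟨M, h1, h2, h3⟩
  exfalso
  have hd1 := trail_parity h0 hnd0 z
  have hnd' := List.nodup_append.1 h3
  have hd2 := trail_parity h1 hnd'.2.1 z
  rw [if_neg hyz, if_pos rfl] at hd2
  have hdisj : Disjoint L0.toFinset M.toFinset := by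
    rw [Finset.disjoint_left]
    intro a ha hb
    exact hnd'.2.2 a (by simpa using ha) a (by simpa using hb) rfl
  have hsum : degree ends (L0.toFinset ∪ M.toFinset) z =
      degree ends L0.toFinset z + degree ends M.toFinset z := by
    simp only [degree_eq]; exact Finset.sum_union hdisj
  have hne : ∃ f, f ∉ L0 ++ M ∧ z ∈ ends f := by
    by_contra hcon
    push Not at hcon
    have : degree ends Finset.univ z = degree ends (L0.toFinset ∪ M.toFinset) z := by
      simp only [degree_eq]
      symm
      apply Finset.sum_subset (Finset.subset_univ _)
      intro f _ hf
      rw [ct_eq_zero]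
      apply hcon
      simpa using hf
    have h5 := hdeg z
    rw [this, hsum] at h5
    rw [Nat.even_iff] at *
    split_ifs at hd1 <;> omega
  obtain ⟨f, hf, z', hz'⟩ := hne
  have hmax : P (M.length + 1) := by
    refine ⟨M ++ [f], z', h1.append (wk_single.2 hz'), by simp, ?_, by simp⟩
    rw [← List.append_assoc, List.nodup_append]
    exact ⟨h3, by simp, by rintro a ha b hb rfl; simp at hb; exact hf (hb ▸ ha)⟩
  have hle2 : M.length + 1 ≤ Fintype.card E := by
    obtain ⟨M', z', _, _, h3, h4⟩ := hmax
    rw [← h4]; exact hbound M' h3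
  have := Nat.le_findGreatest (P := P) hle2 hmax
  omega

theorem euler (hconn : Connected ends) (hdeg : ∀ v, Even (degree ends Finset.univ v)) (x : V) :
    ∃ L, Wk ends x L x ∧ L.Nodup ∧ ∀ e, e ∈ L := by
  let P : ℕ → Prop := fun n => ∃ L, Wk ends x L x ∧ L.Nodup ∧ L.length = n
  have hP : P 0 := ⟨[], rfl, by simp, rfl⟩
  have hspec := Nat.findGreatest_spec (P := P) (Nat.zero_le (Fintype.card E)) hP
  obtain ⟨L, h1, h2, h3⟩ := hspec
  refine ⟨L, h1, h2, ?_⟩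
  by_contra hcon
  push Not at hcon
  obtain ⟨e, he⟩ := hcon
  -- find a missing edge touching the walk
  have hreach : ∀ z, Reach ends Finset.univ x z →
      (∃ L1 L2, L = L1 ++ L2 ∧ Wk ends x L1 z ∧ Wk ends z L2 x) ∨
      ∃ f y L1 L2, f ∉ L ∧ y ∈ ends f ∧ L = L1 ++ L2 ∧ Wk ends x L1 y ∧ Wk ends y L2 x := by
    intro z hz
    induction hz with
    | refl => exact Or.inl ⟨[], L, rfl, rfl, h1⟩
    | @tail b c _ hbc ih =>
      rcases ih with ⟨L1, L2, hL, ha, hb⟩ | ih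
      · obtain ⟨f, -, hf⟩ := hbc
        by_cases hfL : f ∈ L
        · left
          exact h1.touch (mem_supp.2 ⟨f, hfL, by simp [hf]⟩)
        · right
          exact ⟨f, b, L1, L2, hfL, by simp [hf], hL, ha, hb⟩
      · exact Or.inr ih
  obtain ⟨a, b, hab⟩ : ∃ a b, ends e = s(a, b) := by
    induction h : ends e using Sym2.ind with | _ a b => exact ⟨a, b, rfl⟩
  have : ∃ f y L1 L2, f ∉ L ∧ y ∈ ends f ∧ L = L1 ++ L2 ∧ Wk ends x L1 y ∧ Wk ends y L2 x := by
    rcases hreach a (hconn x a) with ⟨L1, L2, hL, ha, hb⟩ | h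
    · exact ⟨e, a, L1, L2, he, by simp [hab], hL, ha, hb⟩
    · exact h
  obtain ⟨f, y, L1, L2, hf, hy, hL, ha, hb⟩ := this
  obtain ⟨M, m1, m2, m3⟩ := closed_ext hdeg h1 h2 hf hy
  have hnew : (L1 ++ M ++ L2).Nodup := by
    have hp : (L1 ++ M ++ L2).Perm (L ++ M) := by
      rw [hL, List.append_assoc, List.append_assoc]
      exact (List.perm_append_comm).append_left L1
    exact hp.nodup_iff.2 m3
  have hlen : (L1 ++ M ++ L2).length ≤ Fintype.card E := hnew.length_le_card
  have := Nat.le_findGreatest (P := P) hlen ⟨_, (ha.append m1).append hb, hnew, rfl⟩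
  have hM : M.length ≠ 0 := by simpa using m2
  have hLl : L.length = L1.length + L2.length := by rw [hL]; simp
  simp only [List.length_append] at this
  omega

end euler

/-! ### Covers of closed walks -/
section cover
variable (ends : E → Sym2 V) (sgn : E → Bool)

def nN (L : List E) : ℕ := L.countP (fun e => decide (e ∈ nonbridges ends))
def ng (L : List E) : ℕ := L.countP (fun e => decide (e ∈ nonbridges ends ∧ sgn e = true))
def Good (L : List E) : Prop := ∀ e ∈ nonbridges ends, L.count e ≤ 1
def Cov (L : List E) : Prop :=
  ∃ 𝒞 : List (Finset E), (∀ C ∈ 𝒞, IsSignedCircuit ends sgn C) ∧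
    (∀ e ∈ L, e ∈ nonbridges ends → ∃ C ∈ 𝒞, e ∈ C) ∧
    3 * totalLength 𝒞 ≤ 2 * (L.length + nN ends L)

def MainClaim : Prop := ∀ L x, Wk ends x L x → Good ends L → Even (ng ends sgn L) → Cov ends sgn L

variable {ends sgn}

theorem mem_nonbridges {e : E} : e ∈ nonbridges ends ↔ ¬ IsBridgeIn ends Finset.univ e := by
  simp [nonbridges, bridges]

theorem wk_map {E' : Type} {ends' : E' → Sym2 V} {π : E' → E} (h : ∀ p, ends' p = ends (π p))
    {u v : V} {L : List E'} (hL : Wk ends' u L v) : Wk ends u (L.map π) v := by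
  induction L generalizing u with
  | nil => exact hL
  | cons e L ih =>
    obtain ⟨x, hx, h1⟩ := hL
    exact ⟨x, by rw [← h, hx], ih h1⟩

theorem Good.nodup {L : List E} (h : Good ends L) :
    (L.filter (fun e => decide (e ∈ nonbridges ends))).Nodup := by
  rw [List.nodup_iff_count_le_one]
  intro a
  by_cases ha : a ∈ nonbridges ends
  · exact (List.Sublist.count_le a List.filter_sublist).trans (h a ha)
  · rw [List.count_eq_zero_of_not_mem]
    · simp
    · simp [ha]

theorem top_reduction (hte : IsTreeOfEulerian ends)
    (heven : Even (negEdges sgn (nonbridges ends)).card) (hmain : MainClaim ends sgn) :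
    ∃ 𝒞 : List (Finset E),
      (∀ C ∈ 𝒞, IsSignedCircuit ends sgn C) ∧
      (∀ e : E, ¬ IsBridgeIn ends Finset.univ e → ∃ C ∈ 𝒞, e ∈ C) ∧
      3 * totalLength 𝒞 ≤ 4 * Fintype.card E := by
  rcases isEmpty_or_nonempty V with hV | ⟨⟨x⟩⟩
  · have : IsEmpty E := ⟨fun e => by
      induction h : ends e using Sym2.ind with | _ a b => exact hV.elim a⟩
    exact ⟨[], by simp, fun e => this.elim e, by simp [totalLength]⟩
  let π : E ⊕ {e // e ∉ nonbridges ends} → E := Sum.elim id Subtype.val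
  let ends' : E ⊕ {e // e ∉ nonbridges ends} → Sym2 V := fun p => ends (π p)
  have hconn : Connected ends' := by
    intro u v
    have := hte.1 u v
    induction this with
    | refl => exact Relation.ReflTransGen.refl
    | tail _ h ih =>
      obtain ⟨e, -, he⟩ := h
      exact Relation.ReflTransGen.tail ih ⟨Sum.inl e, by simp, he⟩
  have hdeg : ∀ v, Even (degree ends' Finset.univ v) := by
    intro v
    have h1 : degree ends' Finset.univ v =
        degree ends (nonbridges ends) v + 2 * degree ends (nonbridges ends)ᶜ v := by
      simp only [degree_eq]
      rw [Fintype.sum_sum_type]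
      have h2 : ∑ p : {e // e ∉ nonbridges ends}, ct ends' (Sum.inr p) v =
          ∑ e ∈ (nonbridges ends)ᶜ, ct ends e v := by
        rw [Finset.sum_subtype (p := fun e => e ∉ nonbridges ends) (F := inferInstance) _ (by simp)]
        rfl
      have h3 : ∑ e : E, ct ends' (Sum.inl e) v = ∑ e : E, ct ends e v := rfl
      rw [h2, h3, ← Finset.sum_add_sum_compl (nonbridges ends)]
      ring
    rw [h1]
    exact (hte.2 v).add (even_two_mul _)
  obtain ⟨L', hw, hnd, hall⟩ := euler hconn hdeg x
  set L := L'.map π with hLdef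
  have hwL : Wk ends x L x := wk_map (π := π) (ends' := ends') (fun _ => rfl) hw
  have hmem : ∀ e, e ∈ L := fun e => List.mem_map.2 ⟨Sum.inl e, hall _, rfl⟩
  have hgood : Good ends L := by
    intro e he
    rw [hLdef, List.count_eq_countP, List.countP_map]
    rw [List.countP_eq_length_filter, ← List.toFinset_card_of_nodup (hnd.filter _),
      Finset.card_le_one]
    have key : ∀ p ∈ (L'.filter ((fun a => a == e) ∘ π)).toFinset, p = Sum.inl e := by
      rintro (a | ⟨a, ha⟩) h
      · simp [π] at h; rw [h.2]
      · simp [π] at h; exact absurd he (h.2 ▸ ha)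
    intro p hp q hq
    rw [key p hp, key q hq]
  have hfin : (L.filter (fun e => decide (e ∈ nonbridges ends))).toFinset = nonbridges ends := by
    ext e; simp [hmem]
  have hng : ng ends sgn L = (negEdges sgn (nonbridges ends)).card := by
    unfold ng negEdges
    rw [← hfin, ← List.toFinset_filter, List.toFinset_card_of_nodup (hgood.nodup.filter _),
      List.filter_filter, List.countP_eq_length_filter]
    congr 2
    ext e
    rw [hfin]; simp [and_comm]
  have hnN : nN ends L = (nonbridges ends).card := by
    unfold nN
    rw [List.countP_eq_length_filter, ← List.toFinset_card_of_nodup hgood.nodup, hfin]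
  have hlen : L.length = Fintype.card E + (nonbridges ends)ᶜ.card := by
    rw [hLdef, List.length_map, ← List.toFinset_card_of_nodup hnd]
    have : L'.toFinset = Finset.univ := by ext p; simp [hall]
    rw [this, Finset.card_univ, Fintype.card_sum, Fintype.card_subtype]
    congr 2
    ext e; simp
  obtain ⟨𝒞, h1, h2, h3⟩ := hmain L x hwL hgood (by rw [hng]; exact heven)
  refine ⟨𝒞, h1, fun e he => h2 e (hmem e) (mem_nonbridges.2 he), ?_⟩
  have := Finset.card_compl_add_card (nonbridges ends)
  rw [hlen, hnN] at h3
  omega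

end cover

/-! ### Barbells -/
section barbell
variable {ends : E → Sym2 V} {sgn : E → Bool}

theorem Cyc.mem_nb {x : V} {C : List E} (h : Cyc ends x C) {e : E} (he : e ∈ C) :
    e ∈ nonbridges ends := by
  rw [mem_nonbridges]
  rintro ⟨-, hb⟩
  obtain ⟨hw, -, hnd, -⟩ := h
  obtain ⟨s, t, rfl⟩ := List.append_of_mem he
  obtain ⟨a, h1, b, hab, h2⟩ := wk_append.1 hw
  refine hb a b hab (reach_symm ((h2.append h1).reach ?_))
  intro f hf
  have hne : f ≠ e := by
    rintro rfl
    have := (List.nodup_middle.1 hnd)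
    rw [List.nodup_cons] at this
    apply this.1
    simp at hf ⊢; tauto
  simp [hne]

theorem Cyc.ng_eq {x : V} {C : List E} (h : Cyc ends x C) :
    (negEdges sgn C.toFinset).card = ng ends sgn C := by
  unfold negEdges ng
  rw [← List.toFinset_filter, List.toFinset_card_of_nodup (h.2.2.1.filter _),
    List.countP_eq_length_filter]
  congr 1
  apply List.filter_congr
  intro e he
  simp [h.mem_nb he]

theorem Cyc.unb {x : V} {C : List E} (h : Cyc ends x C) (ho : Odd (ng ends sgn C)) :
    IsUnbalancedCircuit ends sgn C.toFinset := ⟨h.2.2.2, by rw [h.ng_eq]; exact ho⟩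

theorem Cyc.bal {x : V} {C : List E} (h : Cyc ends x C) (ho : Even (ng ends sgn C)) :
    IsSignedCircuit ends sgn C.toFinset := Or.inl ⟨h.2.2.2, by rw [h.ng_eq]; exact ho⟩

theorem Smp.no_loop {u v : V} {P : List E} (h : Smp ends u P v) {e : E} (he : e ∈ P) (a : V) :
    ends e ≠ s(a, a) := by
  intro hl
  obtain ⟨s, t, rfl⟩ := List.append_of_mem he
  obtain ⟨c, h1, b, hab, h2⟩ := wk_append.1 h.1
  rw [hl] at hab
  have : c = a ∧ b = a := by
    simp only [Sym2.eq_iff] at hab; tauto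
  obtain ⟨rfl, rfl⟩ := this
  have := h.2 s [e] t _ (by simp) h1 (wk_single.2 hl) h2
  simp at this

theorem sym2_rep (e : E) : ∃ a b, ends e = s(a, b) := by
  induction h : ends e using Sym2.ind with | _ a b => exact ⟨a, b, rfl⟩

theorem disj_of_one {u v x : V} {P C : List E} (h : Smp ends u P v)
    (hx : ∀ y ∈ support ends P.toFinset, y ∈ support ends C.toFinset → y = x) :
    Disjoint C.toFinset P.toFinset := by
  rw [Finset.disjoint_left]
  intro e he hp
  simp only [List.mem_toFinset] at he hp
  obtain ⟨a, b, hab⟩ := sym2_rep (ends := ends) e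
  have ha : a = x := hx a (mem_supp.2 ⟨e, hp, by simp [hab]⟩) (mem_supp.2 ⟨e, he, by simp [hab]⟩)
  have hb : b = x := hx b (mem_supp.2 ⟨e, hp, by simp [hab]⟩) (mem_supp.2 ⟨e, he, by simp [hab]⟩)
  subst ha; subst hb
  exact h.no_loop hp _ hab

theorem long_barbell {x x' : V} {C C' P : List E}
    (hC : IsUnbalancedCircuit ends sgn C.toFinset) (hC' : IsUnbalancedCircuit ends sgn C'.toFinset)
    (hd : ∀ y ∈ support ends C.toFinset, y ∉ support ends C'.toFinset)
    (hP : Smp ends x P x') (hx : x ∈ support ends C.toFinset) (hx' : x' ∈ support ends C'.toFinset)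
    (h1 : ∀ y ∈ support ends P.toFinset, y ∈ support ends C.toFinset → y = x)
    (h2 : ∀ y ∈ support ends P.toFinset, y ∈ support ends C'.toFinset → y = x') :
    IsSignedCircuit ends sgn (C.toFinset ∪ C'.toFinset ∪ P.toFinset) := by
  right; right
  have hP0 : P ≠ [] := by
    rintro rfl
    have : x = x' := hP.1
    subst this
    exact hd x hx hx'
  refine ⟨C.toFinset, C'.toFinset, P.toFinset, x, x', ?_, disj_of_one hP h1, disj_of_one hP h2,
    rfl, hC, hC', ?_, hP.isPath hP0, ?_, ?_⟩
  · rw [Finset.disjoint_left]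
    intro e he he'
    simp only [List.mem_toFinset] at he he'
    obtain ⟨a, b, hab⟩ := sym2_rep (ends := ends) e
    exact hd a (mem_supp.2 ⟨e, he, by simp [hab]⟩) (mem_supp.2 ⟨e, he', by simp [hab]⟩)
  · rw [Finset.disjoint_left]; exact hd
  · ext y
    simp only [Finset.mem_inter, Finset.mem_singleton]
    constructor
    · rintro ⟨a, b⟩; exact h1 y a b
    · rintro rfl; exact ⟨hP.1.start_mem hP0, hx⟩
  · ext y
    simp only [Finset.mem_inter, Finset.mem_singleton]
    constructor
    · rintro ⟨a, b⟩; exact h2 y a b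
    · rintro rfl; exact ⟨hP.1.end_mem hP0, hx'⟩

theorem short_barbell {x : V} {C C' : List E}
    (hC : IsUnbalancedCircuit ends sgn C.toFinset) (hC' : IsUnbalancedCircuit ends sgn C'.toFinset)
    (hdis : ∀ e ∈ C, e ∉ C')
    (hx : x ∈ support ends C.toFinset) (hx' : x ∈ support ends C'.toFinset)
    (h1 : ∀ y ∈ support ends C.toFinset, y ∈ support ends C'.toFinset → y = x) :
    IsSignedCircuit ends sgn (C.toFinset ∪ C'.toFinset) := by
  right; left
  refine ⟨C.toFinset, C'.toFinset, ?_, rfl, hC, hC', x, ?_⟩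
  · rw [Finset.disjoint_left]
    intro e he he'
    exact hdis e (by simpa using he) (by simpa using he')
  · ext y
    simp only [Finset.mem_inter, Finset.mem_singleton]
    constructor
    · rintro ⟨a, b⟩; exact h1 y a b
    · rintro rfl; exact ⟨hx, hx'⟩

/-- two circuits joined by a walk -/
theorem join_pair {C C' : List E}
    (hC : IsUnbalancedCircuit ends sgn C.toFinset) (hC' : IsUnbalancedCircuit ends sgn C'.toFinset)
    (hdis : ∀ e ∈ C, e ∉ C')
    (hone : ∀ y ∈ support ends C.toFinset, y ∈ support ends C'.toFinset →
      ∀ z ∈ support ends C.toFinset, z ∈ support ends C'.toFinset → y = z)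
    {M : List E} {a b : V} (hM : Wk ends a M b) (ha : a ∈ support ends C.toFinset)
    (hb : b ∈ support ends C'.toFinset) :
    ∃ F, IsSignedCircuit ends sgn F ∧ C.toFinset ⊆ F ∧ C'.toFinset ⊆ F ∧
      F.card ≤ C.length + C'.length + M.length := by
  have hcard : (C.toFinset ∪ C'.toFinset).card ≤ C.length + C'.length :=
    (Finset.card_union_le _ _).trans
      (Nat.add_le_add (List.toFinset_card_le _) (List.toFinset_card_le _))
  by_cases hsh : ∃ x, x ∈ support ends C.toFinset ∧ x ∈ support ends C'.toFinset
  · obtain ⟨x, hx, hx'⟩ := hsh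
    exact ⟨_, short_barbell hC hC' hdis hx hx' (fun y h h' => hone y h h' x hx hx'),
      Finset.subset_union_left, Finset.subset_union_right, by omega⟩
  push Not at hsh
  have hex : ∃ n, ∃ M a b, Wk ends a M b ∧ a ∈ support ends C.toFinset ∧
      b ∈ support ends C'.toFinset ∧ M.length = n := ⟨_, M, a, b, hM, ha, hb, rfl⟩
  obtain ⟨P, x, x', hP, hx, hx', hlen⟩ := Nat.find_spec hex
  have hmin : ∀ {M a b}, Wk ends a M b → a ∈ support ends C.toFinset →
      b ∈ support ends C'.toFinset → P.length ≤ M.length := by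
    intro M a b h1 h2 h3
    rw [hlen]; exact Nat.find_min' hex ⟨M, a, b, h1, h2, h3, rfl⟩
  have hS : Smp ends x P x' := by
    refine ⟨hP, fun L1 L2 L3 y hl h1 h2 h3 => ?_⟩
    have := hmin (h1.append h3) hx hx'
    rw [hl] at this
    simp only [List.length_append] at this
    exact List.eq_nil_of_length_eq_zero (by omega)
  refine ⟨_, long_barbell hC hC' hsh hS hx hx' ?_ ?_, ?_, ?_, ?_⟩
  · intro y hy hyC
    obtain ⟨L1, L2, rfl, h1, h2⟩ := hP.touch hy
    have := hmin h2 hyC hx'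
    simp at this
    subst this
    exact (wk_nil.1 h1).symm
  · intro y hy hyC
    obtain ⟨L1, L2, rfl, h1, h2⟩ := hP.touch hy
    have := hmin h1 hx hyC
    simp at this
    subst this
    exact wk_nil.1 h2
  · exact Finset.subset_union_left.trans Finset.subset_union_left
  · exact Finset.subset_union_right.trans Finset.subset_union_left
  · refine (Finset.card_union_le _ _).trans ?_
    have := List.toFinset_card_le P
    have := hmin hM ha hb
    omega

/-! ### Additivity -/

theorem ng_append (L1 L2 : List E) : ng ends sgn (L1 ++ L2) = ng ends sgn L1 + ng ends sgn L2 :=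
  List.countP_append
theorem nN_append (L1 L2 : List E) : nN ends (L1 ++ L2) = nN ends L1 + nN ends L2 :=
  List.countP_append
theorem ng_perm {L1 L2 : List E} (h : L1.Perm L2) : ng ends sgn L1 = ng ends sgn L2 :=
  h.countP_eq _
theorem nN_perm {L1 L2 : List E} (h : L1.Perm L2) : nN ends L1 = nN ends L2 :=
  h.countP_eq _
theorem ng_rev (L : List E) : ng ends sgn L.reverse = ng ends sgn L :=
  ng_perm L.reverse_perm
theorem ng_nil : ng ends sgn [] = 0 := rfl

theorem Good.perm {L1 L2 : List E} (h : Good ends L1) (hp : L1.Perm L2) : Good ends L2 :=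
  fun e he => by rw [← hp.count_eq]; exact h e he
theorem Good.left {L1 L2 : List E} (h : Good ends (L1 ++ L2)) : Good ends L1 :=
  fun e he => by have := h e he; rw [List.count_append] at this; omega
theorem Good.right {L1 L2 : List E} (h : Good ends (L1 ++ L2)) : Good ends L2 :=
  fun e he => by have := h e he; rw [List.count_append] at this; omega
theorem Good.disj {L1 L2 : List E} (h : Good ends (L1 ++ L2)) {e : E} (he : e ∈ nonbridges ends)
    (h1 : e ∈ L1) (h2 : e ∈ L2) : False := by
  have := h e he; rw [List.count_append] at this
  have := List.count_pos_iff.2 h1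
  have := List.count_pos_iff.2 h2
  omega

theorem totalLength_append (a b : List (Finset E)) :
    totalLength (a ++ b) = totalLength a + totalLength b := by
  simp [totalLength]

theorem Cov.add {L L1 L2 : List E} (hp : L.Perm (L1 ++ L2)) (h1 : Cov ends sgn L1)
    (h2 : Cov ends sgn L2) : Cov ends sgn L := by
  obtain ⟨A, a1, a2, a3⟩ := h1
  obtain ⟨B, b1, b2, b3⟩ := h2
  refine ⟨A ++ B, ?_, ?_, ?_⟩
  · intro C hC
    rcases List.mem_append.1 hC with h | h
    · exact a1 C h
    · exact b1 C h
  · intro e he hN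
    rcases List.mem_append.1 (hp.mem_iff.1 he) with h | h
    · obtain ⟨C, hC, h⟩ := a2 e h hN; exact ⟨C, by simp [hC], h⟩
    · obtain ⟨C, hC, h⟩ := b2 e h hN; exact ⟨C, by simp [hC], h⟩
  · rw [totalLength_append, nN_perm hp, nN_append, hp.length_eq, List.length_append]
    omega

theorem Cov.nil : Cov ends sgn [] := ⟨[], by simp, by simp, by simp [totalLength]⟩

theorem Cyc.nN_eq {x : V} {C : List E} (h : Cyc ends x C) : nN ends C = C.length := by
  unfold nN
  rw [List.countP_eq_length]
  intro e he
  simpa using h.mem_nb he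

theorem Cyc.cov {x : V} {C : List E} (h : Cyc ends x C) (he : Even (ng ends sgn C)) :
    Cov ends sgn C := by
  refine ⟨[C.toFinset], ?_, ?_, ?_⟩
  · intro F hF; simp at hF; subst hF; exact h.bal he
  · intro e he _; exact ⟨_, List.mem_singleton.2 rfl, by simpa using he⟩
  · have := List.toFinset_card_le C
    rw [h.nN_eq]
    simp [totalLength]
    omega

theorem smp_closed {x : V} {L : List E} (h : Smp ends x L x) : L = [] :=
  h.2 [] L [] x (by simp) rfl h.1 rfl

theorem back_not_mem {e : E} (h : Good ends [e, e]) : e ∉ nonbridges ends := by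
  intro he
  have := h e he
  simp at this

end barbell

section decomp
variable {ends : E → Sym2 V} {sgn : E → Bool}

theorem Wk.rot {u x : V} {C : List E} (h : Wk ends u C u) (hx : x ∈ support ends C.toFinset) :
    ∃ C1, Wk ends x C1 x ∧ C.Perm C1 := by
  obtain ⟨A, B, rfl, h1, h2⟩ := h.touch hx
  exact ⟨B ++ A, h2.append h1, List.perm_append_comm⟩

theorem supp_perm {L L' : List E} (h : L.Perm L') {y : V} :
    y ∈ support ends L.toFinset ↔ y ∈ support ends L'.toFinset := by
  simp only [mem_supp, h.mem_iff]

theorem two_split {u x z : V} {C : List E} (h : Wk ends u C u) (ho : Odd (ng ends sgn C))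
    (hx : x ∈ support ends C.toFinset) (hz : z ∈ support ends C.toFinset) (q : ℕ) :
    ∃ A B, Wk ends x A z ∧ Wk ends x B z ∧ C.Perm (A ++ B) ∧ Even (q + ng ends sgn A) := by
  obtain ⟨C1, h1, hp⟩ := h.rot hx
  obtain ⟨A, B, rfl, hA, hB⟩ := h1.touch ((supp_perm hp).1 hz)
  rw [ng_perm hp, ng_append] at ho
  by_cases hq : Even (q + ng ends sgn A)
  · refine ⟨A, B.reverse, hA, hB.rev, hp.trans ?_, hq⟩
    exact (B.reverse_perm.symm).append_left A
  · refine ⟨B.reverse, A, hB.rev, hA, hp.trans ?_, ?_⟩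
    · exact List.perm_append_comm.trans (B.reverse_perm.symm.append_right A)
    · rw [ng_rev]
      rw [Nat.even_iff] at hq ⊢
      rw [Nat.odd_iff] at ho
      omega

theorem wk_ne_nil {x z : V} {L : List E} (h : Wk ends x L z) (hne : x ≠ z) : L ≠ [] := by
  rintro rfl; exact hne h

theorem theta {u u' x z : V} {C C' : List E} (h : Wk ends u C u) (h' : Wk ends u' C' u')
    (ho : Odd (ng ends sgn C)) (ho' : Odd (ng ends sgn C')) (hne : x ≠ z)
    (hx : x ∈ support ends C.toFinset) (hz : z ∈ support ends C.toFinset)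
    (hx' : x ∈ support ends C'.toFinset) (hz' : z ∈ support ends C'.toFinset) :
    ∃ L1 L2, Wk ends x L1 x ∧ Wk ends x L2 x ∧ L1 ≠ [] ∧ L2 ≠ [] ∧ Even (ng ends sgn L1) ∧
      Even (ng ends sgn L2) ∧ (C ++ C').Perm (L1 ++ L2) := by
  obtain ⟨A, B, hA, hB, hp, -⟩ := two_split h ho hx hz 0
  obtain ⟨A', B', hA', hB', hp', he⟩ := two_split h' ho' hx' hz' (ng ends sgn A)
  have hperm : (C ++ C').Perm ((A ++ A'.reverse) ++ (B ++ B'.reverse)) := by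
    refine (hp.append hp').trans ?_
    have h1 : ((A ++ B) ++ (A' ++ B')).Perm ((A ++ A') ++ (B ++ B')) := by
      rw [← Multiset.coe_eq_coe]
      simp only [← Multiset.coe_add]
      abel
    refine h1.trans ?_
    exact ((A'.reverse_perm.symm).append_left A).append ((B'.reverse_perm.symm).append_left B)
  have h1 : Even (ng ends sgn (A ++ A'.reverse)) := by rw [ng_append, ng_rev]; exact he
  refine ⟨A ++ A'.reverse, B ++ B'.reverse, hA.append hA'.rev, hB.append hB'.rev, ?_, ?_, h1,
    ?_, hperm⟩
  · simp [wk_ne_nil hA hne]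
  · simp [wk_ne_nil hB hne]
  · have := ng_perm (ends := ends) (sgn := sgn) hperm
    rw [ng_append, ng_append (ends := ends) (sgn := sgn) (A ++ A'.reverse)] at this
    have h2 := ho.add_odd ho'
    rw [this] at h2
    exact (Nat.even_add.1 h2).1 h1

/-! decompositions into circuits -/

def Dec (ends : E → Sym2 V) (L : List E) (D : List (List E)) : Prop :=
  (∀ c ∈ D, ∃ x, Cyc ends x c) ∧
    (L.filter (fun e => decide (e ∈ nonbridges ends))).Perm D.flatten

def fval (ends : E → Sym2 V) (sgn : E → Bool) (D : List (List E)) : ℕ :=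
  (D.map (fun c => if Even (ng ends sgn c) then 2 else 1)).sum

theorem dec_exists : ∀ (n : ℕ) (L : List E) (x : V), L.length = n → Wk ends x L x → Good ends L →
    ∃ D, Dec ends L D := by
  intro n
  induction n using Nat.strong_induction_on with
  | _ n ih =>
    intro L x hn hw hg
    by_cases hL : L = []
    · exact ⟨[], by simp, by simp [hL]⟩
    · obtain ⟨L1, L2, L3, y, rfl, h1, h3, h2, hne, hc⟩ :=
        extract hw (fun h => hL (smp_closed h))
      have hpos : 0 < L2.length := List.length_pos_iff.2 hne
      have hp : (L1 ++ L2 ++ L3).Perm (L2 ++ (L1 ++ L3)) := by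
        rw [List.append_assoc]
        exact List.perm_append_comm_assoc L1 L2 L3
      have hg' := hg.perm hp
      obtain ⟨D, d1, d2⟩ := ih (L1 ++ L3).length (by simp at hn ⊢; omega) (L1 ++ L3) x rfl
        (h1.append h3) hg'.right
      rcases hc with hc | ⟨e, rfl⟩
      · refine ⟨L2 :: D, ?_, ?_⟩
        · intro c hc'
          rcases List.mem_cons.1 hc' with rfl | h
          · exact ⟨y, hc⟩
          · exact d1 c h
        · refine (hp.filter _).trans ?_
          rw [List.filter_append, List.flatten_cons]
          refine List.Perm.append ?_ d2
          rw [List.filter_eq_self.2]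
          intro e he
          simpa using hc.mem_nb he
      · refine ⟨D, d1, ?_⟩
        refine (hp.filter _).trans ?_
        rw [List.filter_append]
        have := back_not_mem hg'.left
        simpa [this] using d2

theorem fval_append (D D' : List (List E)) :
    fval ends sgn (D ++ D') = fval ends sgn D + fval ends sgn D' := by simp [fval]

theorem fval_perm {D D' : List (List E)} (h : D.Perm D') : fval ends sgn D = fval ends sgn D' :=
  (h.map _).sum_eq

theorem fval_even {L : List E} {D : List (List E)} (hD : L.Perm D.flatten) (hL : L ≠ [])
    (he : Even (ng ends sgn L)) : 2 ≤ fval ends sgn D := by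
  match D, hD with
  | [], hD => simp at hD; exact absurd hD hL
  | [c], hD =>
    have hD : L.Perm c := by simpa using hD
    rw [ng_perm hD] at he
    simp [fval, he]
  | c :: c' :: D, _ =>
    simp only [fval, List.map_cons, List.sum_cons]
    split_ifs <;> omega

theorem fval_le {D : List (List E)} (h : ∀ c ∈ D, c ≠ []) : fval ends sgn D ≤ 2 * D.flatten.length := by
  induction D with
  | nil => simp [fval]
  | cons c D ih =>
    have := ih (fun c hc => h c (by simp [hc]))
    have h1 : 0 < c.length := List.length_pos_iff.2 (h c (by simp))
    simp only [fval, List.map_cons, List.sum_cons, List.flatten_cons, List.length_append] at this ⊢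
    split_ifs <;> omega

theorem pairwise_of_perm {α : Type} {R : α → α → Prop} {l : List α}
    (h : ∀ a b r, l.Perm (a :: b :: r) → R a b) : l.Pairwise R := by
  induction l with
  | nil => simp
  | cons a l ih =>
    rw [List.pairwise_cons]
    constructor
    · intro b hb
      obtain ⟨s, t, rfl⟩ := List.append_of_mem hb
      exact h a b (s ++ t) (List.perm_middle.cons a)
    · apply ih
      intro c d r hp
      refine h c d (a :: r) ((hp.cons a).trans ?_)
      exact (List.Perm.swap c a _).trans ((List.Perm.swap d a r).cons c)

theorem filter_self_of_nb {L : List E} (h : ∀ e ∈ L, e ∈ nonbridges ends) :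
    L.filter (fun e => decide (e ∈ nonbridges ends)) = L := by
  rw [List.filter_eq_self]; intro e he; simpa using h e he

/-- the good relation between circuits of an optimal decomposition -/
def RelP (ends : E → Sym2 V) (c c' : List E) : Prop :=
  (∀ e ∈ c, e ∉ c') ∧ ∀ y ∈ support ends c.toFinset, y ∈ support ends c'.toFinset →
      ∀ z ∈ support ends c.toFinset, z ∈ support ends c'.toFinset → y = z

theorem RelP.symm {c c' : List E} (h : RelP ends c c') : RelP ends c' c :=
  ⟨fun e he he' => h.1 e he' he, fun y hy hy' z hz hz' => h.2 y hy' hy z hz' hz⟩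

theorem dec_best {L : List E} {x : V} (hw : Wk ends x L x) (hg : Good ends L) :
    ∃ D, Dec ends L D ∧
      D.Pairwise (fun c c' => Odd (ng ends sgn c) → Odd (ng ends sgn c') → RelP ends c c') := by
  let P : ℕ → Prop := fun n => ∃ D, Dec ends L D ∧ fval ends sgn D = n
  have hb : ∀ D, Dec ends L D → fval ends sgn D ≤ 2 * L.length := by
    intro D hD
    have h1 := fval_le (ends := ends) (sgn := sgn) (D := D) (fun c hc => by
      obtain ⟨y, hy⟩ := hD.1 c hc; exact hy.2.1)
    rw [← hD.2.length_eq] at h1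
    have := List.length_filter_le (fun e => decide (e ∈ nonbridges ends)) L
    omega
  obtain ⟨D0, hD0⟩ := dec_exists L.length L x rfl hw hg
  obtain ⟨D, hD, hf⟩ := Nat.findGreatest_spec (P := P) (hb D0 hD0) ⟨D0, hD0, rfl⟩
  refine ⟨D, hD, pairwise_of_perm ?_⟩
  intro c c' r hp ho ho'
  have hfl : (L.filter (fun e => decide (e ∈ nonbridges ends))).Perm (c ++ c' ++ r.flatten) := by
    refine hD.2.trans (hp.flatten.trans ?_)
    simp
  have hnd : (c ++ c' ++ r.flatten).Nodup := hfl.nodup_iff.1 hg.nodup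
  obtain ⟨a, hc⟩ := hD.1 c (hp.mem_iff.2 (by simp))
  obtain ⟨a', hc'⟩ := hD.1 c' (hp.mem_iff.2 (by simp))
  have hnd' := (List.nodup_append.1 hnd).1
  refine ⟨fun e he he' => (List.nodup_append.1 hnd').2.2 e he e he' rfl, ?_⟩
  intro y hy hy' z hz hz'
  by_contra hne
  obtain ⟨L1, L2, w1, w2, n1, n2, e1, e2, hp2⟩ := theta hc.1 hc'.1 ho ho' hne hy hz hy' hz'
  have hnbL : ∀ e ∈ L1 ++ L2, e ∈ nonbridges ends := by
    intro e he
    rcases List.mem_append.1 (hp2.mem_iff.2 he) with h | h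
    · exact hc.mem_nb h
    · exact hc'.mem_nb h
  have hgL : Good ends (L1 ++ L2) := by
    intro e _
    exact List.nodup_iff_count_le_one.1 (hp2.nodup_iff.1 hnd') e
  obtain ⟨D1, hD1⟩ := dec_exists _ L1 y rfl w1 hgL.left
  obtain ⟨D2, hD2⟩ := dec_exists _ L2 y rfl w2 hgL.right
  have f1 : L1.Perm D1.flatten := by
    have := hD1.2
    rwa [filter_self_of_nb (fun e he => hnbL e (by simp [he]))] at this
  have f2 : L2.Perm D2.flatten := by
    have := hD2.2
    rwa [filter_self_of_nb (fun e he => hnbL e (by simp [he]))] at this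
  have g1 := fval_even f1 n1 e1
  have g2 := fval_even f2 n2 e2
  have hnew : Dec ends L (D1 ++ D2 ++ r) := by
    refine ⟨?_, ?_⟩
    · intro d hd
      simp only [List.mem_append] at hd
      rcases hd with (h | h) | h
      · exact hD1.1 d h
      · exact hD2.1 d h
      · exact hD.1 d (hp.mem_iff.2 (by simp [h]))
    · refine hfl.trans ?_
      rw [List.flatten_append, List.flatten_append]
      exact (hp2.trans (f1.append f2)).append_right _
  have := Nat.le_findGreatest (P := P) (hb _ hnew) ⟨_, hnew, rfl⟩
  rw [← hf, fval_perm hp, fval_append, fval_append] at this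
  simp only [fval, List.map_cons, List.sum_cons] at this g1 g2
  rw [if_neg (Nat.not_even_iff_odd.2 ho), if_neg (Nat.not_even_iff_odd.2 ho')] at this
  omega

end decomp

section pcov
variable {ends : E → Sym2 V} {sgn : E → Bool}

def Jn (ends : E → Sym2 V) (sgn : E → Bool) (c c' : List E) (d : ℕ) : Prop :=
  ∃ F, IsSignedCircuit ends sgn F ∧ c.toFinset ⊆ F ∧ c'.toFinset ⊆ F ∧
    F.card ≤ c.length + c'.length + d

theorem pairing (f : List E → ℕ) : ∀ (n : ℕ) (mid : List (List E)), mid.length = 2 * n →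
    ∀ c1 cl, (c1 :: (mid ++ [cl])).Pairwise
      (fun c c' => f c ≤ f c' ∧ Jn ends sgn c c' (f c' - f c)) →
    ∃ A B : List (Finset E), (∀ F ∈ A, IsSignedCircuit ends sgn F) ∧
      (∀ F ∈ B, IsSignedCircuit ends sgn F) ∧
      (∀ c ∈ c1 :: (mid ++ [cl]), ∃ F ∈ A, c.toFinset ⊆ F) ∧
      (∀ c ∈ mid, ∃ F ∈ B, c.toFinset ⊆ F) ∧
      totalLength A + totalLength B ≤
        c1.length + cl.length + 2 * mid.flatten.length + (f cl - f c1) := by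
  intro n
  induction n with
  | zero =>
    intro mid hm c1 cl hP
    have : mid = [] := List.length_eq_zero_iff.1 (by omega)
    subst this
    simp only [List.nil_append, List.pairwise_cons, List.mem_singleton, forall_eq] at hP
    obtain ⟨F, h1, h2, h3, h4⟩ := hP.1.2
    refine ⟨[F], [], by simpa using h1, by simp, ?_, by simp, ?_⟩
    · simp [h2, h3]
    · simp [totalLength]; omega
  | succ n ih =>
    intro mid hm c1 cl hP
    match mid, hm with
    | a :: b :: m, hm =>
      have hP0 := hP
      simp only [List.cons_append] at hP
      have q1 := (List.pairwise_cons.1 hP).1 a (by simp)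
      have q2 := (List.pairwise_cons.1 (List.pairwise_cons.1 hP).2).1 b (by simp)
      have q3 := (List.pairwise_cons.1 (List.pairwise_cons.1 (List.pairwise_cons.1 hP).2).2).1 cl
        (by simp)
      obtain ⟨A, B, a1, b1, a2, b2, ht⟩ := ih m (by simp at hm; omega) b cl
        (List.pairwise_cons.1 (List.pairwise_cons.1 hP).2).2
      obtain ⟨F, h1, h2, h3, h4⟩ := q1.2
      obtain ⟨G, g1, g2, g3, g4⟩ := q2.2
      refine ⟨F :: A, G :: B, ?_, ?_, ?_, ?_, ?_⟩
      · intro X hX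
        rcases List.mem_cons.1 hX with rfl | h
        · exact h1
        · exact a1 X h
      · intro X hX
        rcases List.mem_cons.1 hX with rfl | h
        · exact g1
        · exact b1 X h
      · intro c hc
        simp only [List.cons_append, List.mem_cons] at hc
        rcases hc with rfl | rfl | hc
        · exact ⟨F, by simp, h2⟩
        · exact ⟨F, by simp, h3⟩
        · obtain ⟨X, x1, x2⟩ := a2 c (by simpa using hc)
          exact ⟨X, by simp [x1], x2⟩
      · intro c hc
        simp only [List.mem_cons] at hc
        rcases hc with rfl | rfl | hc
        · exact ⟨G, by simp, g2⟩
        · exact ⟨G, by simp, g3⟩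
        · obtain ⟨X, x1, x2⟩ := b2 c hc
          exact ⟨X, by simp [x1], x2⟩
      · have := q1.1
        have := q2.1
        have := q3.1
        simp only [totalLength, List.map_cons, List.sum_cons, List.flatten_cons,
          List.length_append] at ht ⊢
        omega

theorem even_odds (D : List (List E)) : Even (ng ends sgn D.flatten) ↔
    Even (D.filter (fun c => decide (Odd (ng ends sgn c)))).length := by
  induction D with
  | nil => simp [ng]
  | cons c D ih =>
    rw [List.flatten_cons, ng_append, Nat.even_add, ih]
    by_cases h : Odd (ng ends sgn c)
    · rw [List.filter_cons_of_pos (by simpa using h), List.length_cons, Nat.even_add_one]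
      have := Nat.not_even_iff_odd.2 h
      tauto
    · rw [List.filter_cons_of_neg (by simpa using h)]
      have := Nat.not_odd_iff_even.1 h
      tauto

theorem ng_filter (L : List E) :
    ng ends sgn (L.filter (fun e => decide (e ∈ nonbridges ends))) = ng ends sgn L := by
  unfold ng
  rw [List.countP_filter]
  apply List.countP_congr
  intro e _
  simp
  tauto

theorem pcover {L W : List E} {u : V} {D : List (List E)} (he : Even (ng ends sgn L))
    (hD : Dec ends L D)
    (hR : D.Pairwise (fun c c' => Odd (ng ends sgn c) → Odd (ng ends sgn c') → RelP ends c c'))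
    (ht : ∀ c ∈ D, Odd (ng ends sgn c) → ∃ y ∈ support ends c.toFinset, ∃ W1 W2, W = W1 ++ W2 ∧
      Wk ends u W1 y ∧ Wk ends y W2 u) :
    ∃ A B : List (Finset E), (∀ F ∈ A, IsSignedCircuit ends sgn F) ∧
      (∀ F ∈ B, IsSignedCircuit ends sgn F) ∧
      (∀ c ∈ D, ∃ F ∈ A, c.toFinset ⊆ F) ∧ (∀ c ∈ D, ∃ F ∈ B, c.toFinset ⊆ F) ∧
      totalLength A + totalLength B ≤ 2 * D.flatten.length + W.length := by
  have ht' : ∀ c, ∃ p, c ∈ D → Odd (ng ends sgn c) → p ≤ W.length ∧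
      ∃ y ∈ support ends c.toFinset, Wk ends u (W.take p) y ∧ Wk ends y (W.drop p) u := by
    intro c
    by_cases h : c ∈ D ∧ Odd (ng ends sgn c)
    · obtain ⟨y, hy, W1, W2, rfl, h1, h2⟩ := ht c h.1 h.2
      exact ⟨W1.length, fun _ _ => ⟨by simp, y, hy, by simpa using h1, by simpa using h2⟩⟩
    · exact ⟨0, fun a b => absurd ⟨a, b⟩ h⟩
  choose f hf using ht'
  set O := D.filter (fun c => decide (Odd (ng ends sgn c))) with hO
  set Ev := D.filter (fun c => !decide (Odd (ng ends sgn c))) with hEv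
  have hperm : (O ++ Ev).Perm D := List.filter_append_perm _ D
  have hOe : Even O.length := by
    rw [hO, ← even_odds, ← ng_perm hD.2, ng_filter]; exact he
  have hEvS : ∀ F ∈ Ev.map List.toFinset, IsSignedCircuit ends sgn F := by
    intro F hF
    obtain ⟨c, hc, rfl⟩ := List.mem_map.1 hF
    simp only [hEv, List.mem_filter] at hc
    obtain ⟨x, hx⟩ := hD.1 c hc.1
    exact hx.bal (by simpa using hc.2)
  have hEvT : totalLength (Ev.map List.toFinset) ≤ Ev.flatten.length := by
    clear_value Ev
    clear hEvS hperm hEv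
    induction Ev with
    | nil => simp [totalLength]
    | cons c D ih =>
      have := List.toFinset_card_le c
      simp only [totalLength, List.map_cons, List.sum_cons, List.flatten_cons,
        List.length_append] at ih ⊢
      omega
  have hlen : D.flatten.length = O.flatten.length + Ev.flatten.length := by
    rw [← hperm.flatten.length_eq]; simp
  -- key: it suffices to cover O
  suffices h : ∃ A B : List (Finset E), (∀ F ∈ A, IsSignedCircuit ends sgn F) ∧
      (∀ F ∈ B, IsSignedCircuit ends sgn F) ∧
      (∀ c ∈ O, ∃ F ∈ A, c.toFinset ⊆ F) ∧ (∀ c ∈ O, ∃ F ∈ B, c.toFinset ⊆ F) ∧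
      totalLength A + totalLength B ≤ 2 * O.flatten.length + W.length by
    obtain ⟨A, B, a1, b1, a2, b2, h3⟩ := h
    have cv : ∀ X : List (Finset E), (∀ c ∈ O, ∃ F ∈ X, c.toFinset ⊆ F) →
        ∀ c ∈ D, ∃ F ∈ X ++ Ev.map List.toFinset, c.toFinset ⊆ F := by
      intro X hX c hc
      rcases List.mem_append.1 (hperm.mem_iff.2 hc) with h | h
      · obtain ⟨F, h1, h2⟩ := hX c h
        exact ⟨F, List.mem_append_left _ h1, h2⟩
      · exact ⟨c.toFinset, List.mem_append_right _ (List.mem_map_of_mem h), subset_rfl⟩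
    refine ⟨A ++ Ev.map List.toFinset, B ++ Ev.map List.toFinset, ?_, ?_, cv A a2, cv B b2, ?_⟩
    · intro F hF
      rcases List.mem_append.1 hF with h | h
      · exact a1 F h
      · exact hEvS F h
    · intro F hF
      rcases List.mem_append.1 hF with h | h
      · exact b1 F h
      · exact hEvS F h
    · rw [totalLength_append, totalLength_append]; omega
  -- sort
  let le : List E → List E → Bool := fun a b => decide (f a ≤ f b)
  set S := O.mergeSort le with hS
  have hSp : S.Perm O := List.mergeSort_perm O le
  have hSs : S.Pairwise (fun a b => le a b = true) :=
    List.pairwise_mergeSort (by intro a b c; simp only [le, decide_eq_true_eq]; omega)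
      (by intro a b; simp only [le, Bool.or_eq_true, decide_eq_true_eq]; omega) O
  have hmem : ∀ c ∈ S, c ∈ D ∧ Odd (ng ends sgn c) := by
    intro c hc
    have := hSp.mem_iff.1 hc
    simpa [hO, List.mem_filter] using this
  have hOR : O.Pairwise (RelP ends) := by
    have h1 : O.Pairwise
        (fun c c' => Odd (ng ends sgn c) → Odd (ng ends sgn c') → RelP ends c c') := hR.filter _
    refine h1.imp_of_mem ?_
    intro a b ha hb h
    exact h (by simpa using (List.mem_filter.1 ha).2) (by simpa using (List.mem_filter.1 hb).2)
  have hSR : S.Pairwise (RelP ends) := (hSp.pairwise_iff (fun h => RelP.symm h)).2 hOR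
  have key : ∀ a ∈ S, ∀ b ∈ S, RelP ends a b → f a ≤ f b →
      Jn ends sgn a b (f b - f a) ∧ Jn ends sgn a b (W.length - (f b - f a)) := by
    intro a ha b hb hr hab
    obtain ⟨ha1, ha2⟩ := hmem a ha
    obtain ⟨hb1, hb2⟩ := hmem b hb
    obtain ⟨xa, hxa⟩ := hD.1 a ha1
    obtain ⟨xb, hxb⟩ := hD.1 b hb1
    obtain ⟨hpa, ya, hya, a1, a2⟩ := hf a ha1 ha2
    obtain ⟨hpb, yb, hyb, b1, b2⟩ := hf b hb1 hb2
    constructor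
    · have e1 : W.take (f b) = W.take (f a) ++ (W.take (f b)).drop (f a) := by
        conv_lhs => rw [← List.take_append_drop (f a) (W.take (f b))]
        rw [List.take_take, min_eq_left hab]
      rw [e1] at b1
      obtain ⟨y, h1, h2⟩ := wk_append.1 b1
      have := h1.unique a1
      subst this
      obtain ⟨F, f1, f2, f3, f4⟩ := join_pair (hxa.unb ha2) (hxb.unb hb2) hr.1 hr.2 h2 hya hyb
      refine ⟨F, f1, f2, f3, f4.trans ?_⟩
      simp only [List.length_drop, List.length_take]
      omega
    · obtain ⟨F, f1, f2, f3, f4⟩ := join_pair (hxb.unb hb2) (hxa.unb ha2) hr.symm.1 hr.symm.2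
        (b2.append a1) hyb hya
      refine ⟨F, f1, f3, f2, f4.trans ?_⟩
      simp only [List.length_append, List.length_drop, List.length_take]
      omega
  have hfin : ∃ A B : List (Finset E), (∀ F ∈ A, IsSignedCircuit ends sgn F) ∧
      (∀ F ∈ B, IsSignedCircuit ends sgn F) ∧
      (∀ c ∈ S, ∃ F ∈ A, c.toFinset ⊆ F) ∧ (∀ c ∈ S, ∃ F ∈ B, c.toFinset ⊆ F) ∧
      totalLength A + totalLength B ≤ 2 * S.flatten.length + W.length := by
    have hSe : Even S.length := by rw [hSp.length_eq]; exact hOe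
    have hboth : S.Pairwise (fun c c' => f c ≤ f c' ∧ Jn ends sgn c c' (f c' - f c)) := by
      refine (hSs.and hSR).imp_of_mem ?_
      intro a b ha hb h
      have h1 : f a ≤ f b := by simpa [le] using h.1
      exact ⟨h1, (key a ha b hb h.2 h1).1⟩
    clear_value S
    rcases S with _ | ⟨c1, rest⟩
    · exact ⟨[], [], by simp, by simp, by simp, by simp, by simp [totalLength]⟩
    · rcases List.eq_nil_or_concat rest with rfl | ⟨mid, cl, rfl⟩
      · simp at hSe
      · rw [List.concat_eq_append] at *
        obtain ⟨n, hn⟩ := hSe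
        obtain ⟨A, B, a1, b1, a2, b2, h3⟩ := pairing f (n - 1) mid
          (by simp at hn; omega) c1 cl hboth
        have hrel := (List.pairwise_cons.1 hSR).1 cl (by simp)
        have hle : f c1 ≤ f cl := ((List.pairwise_cons.1 hboth).1 cl (by simp)).1
        obtain ⟨F, f1, f2, f3, f4⟩ := (key c1 (by simp) cl (by simp) hrel hle).2
        refine ⟨A, F :: B, a1, ?_, a2, ?_, ?_⟩
        · intro X hX
          rcases List.mem_cons.1 hX with rfl | h
          · exact f1
          · exact b1 X h
        · intro c hc
          simp only [List.mem_cons, List.mem_append, List.not_mem_nil, or_false] at hc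
          rcases hc with rfl | hc | rfl
          · exact ⟨F, by simp, f2⟩
          · obtain ⟨X, x1, x2⟩ := b2 c hc
            exact ⟨X, by simp [x1], x2⟩
          · exact ⟨F, by simp, f3⟩
        · have g1 := (hf cl (hmem cl (by simp)).1 (hmem cl (by simp)).2).1
          simp only [totalLength, List.map_cons, List.sum_cons, List.flatten_cons,
            List.length_append, List.flatten_append, List.flatten_nil, List.length_nil] at h3 ⊢
          omega
  obtain ⟨A, B, a1, b1, a2, b2, h3⟩ := hfin
  refine ⟨A, B, a1, b1, fun c hc => a2 c (hSp.mem_iff.2 hc), fun c hc => b2 c (hSp.mem_iff.2 hc), ?_⟩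
  rw [← hSp.flatten.length_eq]
  exact h3

end pcov

section sys
variable {ends : E → Sym2 V} {sgn : E → Bool}

def Sys (ends : E → Sym2 V) (sgn : E → Bool) : V → List (List E × V × List E) → V → Prop
  | u, [], v => u = v
  | u, b :: bs, v => Wk ends u b.1 b.2.1 ∧ Cyc ends b.2.1 b.2.2 ∧ Odd (ng ends sgn b.2.2) ∧
      Sys ends sgn b.2.1 bs v

def fl (bs : List (List E × V × List E)) : List E := (bs.map (fun b => b.1 ++ b.2.2)).flatten
def Pw (bs : List (List E × V × List E)) : List E := (bs.map (fun b => b.1)).flatten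
def Cw (bs : List (List E × V × List E)) : List E := (bs.map (fun b => b.2.2)).flatten

@[simp] theorem fl_nil : fl ([] : List (List E × V × List E)) = [] := rfl
@[simp] theorem fl_cons (b : List E × V × List E) (bs) : fl (b :: bs) = b.1 ++ b.2.2 ++ fl bs := by
  simp [fl]
@[simp] theorem fl_append (a b : List (List E × V × List E)) : fl (a ++ b) = fl a ++ fl b := by
  simp [fl]
@[simp] theorem Pw_nil : Pw ([] : List (List E × V × List E)) = [] := rfl
@[simp] theorem Pw_cons (b : List E × V × List E) (bs) : Pw (b :: bs) = b.1 ++ Pw bs := by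
  simp [Pw]
@[simp] theorem Pw_append (a b : List (List E × V × List E)) : Pw (a ++ b) = Pw a ++ Pw b := by
  simp [Pw]
@[simp] theorem Cw_nil : Cw ([] : List (List E × V × List E)) = [] := rfl
@[simp] theorem Cw_cons (b : List E × V × List E) (bs) : Cw (b :: bs) = b.2.2 ++ Cw bs := by
  simp [Cw]
@[simp] theorem Cw_append (a b : List (List E × V × List E)) : Cw (a ++ b) = Cw a ++ Cw b := by
  simp [Cw]

theorem fl_split (bs : List (List E × V × List E)) : (fl bs).Perm (Pw bs ++ Cw bs) := by
  induction bs with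
  | nil => simp
  | cons b bs ih =>
    rw [fl_cons, Pw_cons, Cw_cons]
    refine (ih.append_left _).trans ?_
    rw [← Multiset.coe_eq_coe]
    simp only [← Multiset.coe_add]
    abel

theorem sys_append {a b : List (List E × V × List E)} {u v : V} :
    Sys ends sgn u (a ++ b) v ↔ ∃ x, Sys ends sgn u a x ∧ Sys ends sgn x b v := by
  induction a generalizing u with
  | nil => simp [Sys]
  | cons c a ih =>
    simp only [List.cons_append, Sys, ih]
    constructor
    · rintro ⟨h1, h2, h3, x, h4, h5⟩; exact ⟨x, ⟨h1, h2, h3, h4⟩, h5⟩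
    · rintro ⟨x, ⟨h1, h2, h3, h4⟩, h5⟩; exact ⟨h1, h2, h3, x, h4, h5⟩

theorem Sys.wk {bs : List (List E × V × List E)} {u v : V} (h : Sys ends sgn u bs v) :
    Wk ends u (fl bs) v := by
  induction bs generalizing u with
  | nil => exact h
  | cons b bs ih =>
    obtain ⟨h1, h2, -, h4⟩ := h
    rw [fl_cons]
    exact (h1.append h2.1).append (ih h4)

theorem Sys.wkP {bs : List (List E × V × List E)} {u v : V} (h : Sys ends sgn u bs v) :
    Wk ends u (Pw bs) v := by
  induction bs generalizing u with
  | nil => exact h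
  | cons b bs ih =>
    obtain ⟨h1, h2, -, h4⟩ := h
    rw [Pw_cons]
    exact h1.append (ih h4)

theorem Cyc.base_mem {x : V} {C : List E} (h : Cyc ends x C) : x ∈ support ends C.toFinset := by
  obtain ⟨h1, h2, -⟩ := h
  rcases C with _ | ⟨e, C⟩
  · exact absurd rfl h2
  · obtain ⟨y, hy, -⟩ := h1
    exact mem_supp.2 ⟨e, by simp, by simp [hy]⟩

def Irr (ends : E → Sym2 V) (sgn : E → Bool) (L : List E) : Prop :=
  ∀ L1 L2 a b, L.Perm (L1 ++ L2) → Wk ends a L1 a → Wk ends b L2 b → L1 ≠ [] → L2 ≠ [] →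
    ¬ Even (ng ends sgn L1)

def Feas (ends : E → Sym2 V) (sgn : E → Bool) (L : List E) (bs : List (List E × V × List E)) :
    Prop := (∃ u, Sys ends sgn u bs u) ∧ L.Perm (fl bs) ∧ bs ≠ []

def Opt (ends : E → Sym2 V) (sgn : E → Bool) (L : List E) (bs : List (List E × V × List E)) :
    Prop := Feas ends sgn L bs ∧ ∀ bs', Feas ends sgn L bs' → (Pw bs).length ≤ (Pw bs').length

theorem Opt.rot {L : List E} {a b : List (List E × V × List E)} (h : Opt ends sgn L (a ++ b)) :
    Opt ends sgn L (b ++ a) := by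
  obtain ⟨⟨⟨u, h1⟩, h2, h3⟩, h4⟩ := h
  obtain ⟨x, h5, h6⟩ := sys_append.1 h1
  refine ⟨⟨⟨x, sys_append.2 ⟨u, h6, h5⟩⟩, ?_, ?_⟩, ?_⟩
  · rw [fl_append] at h2 ⊢
    exact h2.trans List.perm_append_comm
  · simp at h3 ⊢; tauto
  · intro bs' hb
    have := h4 bs' hb
    simp at this ⊢; omega

theorem opt_smp {L P C : List E} {x : V} {bs : List (List E × V × List E)}
    (hg : Good ends L) (hI : Irr ends sgn L) (h : Opt ends sgn L ((P, x, C) :: bs))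
    {u : V} (hs : Sys ends sgn u ((P, x, C) :: bs) u) : Smp ends u P x := by
  by_contra hS
  obtain ⟨h1, h2, h3, h4⟩ := hs
  simp only at h1 h2 h3 h4
  obtain ⟨L1, L2, L3, y, rfl, w1, w3, w2, hne, hc⟩ := extract h1 hS
  have hp : L.Perm (L2 ++ (L1 ++ L3 ++ C ++ fl bs)) := by
    refine h.1.2.1.trans ?_
    rw [fl_cons, ← Multiset.coe_eq_coe]
    simp only [← Multiset.coe_add]
    abel
  have hodd := hI L2 _ y u hp w2 (((w1.append w3).append h2.1).append h4.wk) hne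
    (by simp [h2.2.1])
  rcases hc with hc | ⟨e, rfl⟩
  · have := h.2 ((L1, y, L2) :: (L3, x, C) :: bs) ⟨⟨u, w1, hc, Nat.not_even_iff_odd.1 hodd, w3, h2,
      h3, h4⟩, h.1.2.1.trans (by simp), by simp⟩
    have hl := List.length_pos_iff.2 hne
    simp only [Pw_cons, List.length_append] at this
    omega
  · have := back_not_mem (hg.perm hp).left
    exact hodd (by simp [ng, this])

theorem opt_disj {L : List E} {b1 b2 : List E × V × List E} {m d : List (List E × V × List E)}
    (hI : Irr ends sgn L) (h : Opt ends sgn L (b1 :: (m ++ b2 :: d)))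
    (hr : b1.1 ++ fl m ++ b2.1 ++ fl d ≠ []) :
    ∀ y ∈ support ends b1.2.2.toFinset, y ∉ support ends b2.2.2.toFinset := by
  intro y hy hy'
  obtain ⟨⟨⟨u, h1, h2, h3, h4⟩, hp, -⟩, -⟩ := h
  obtain ⟨x, h5, h6, h7, h8, h9⟩ := sys_append.1 h4
  obtain ⟨C1, r1, p1⟩ := h2.1.rot hy
  obtain ⟨C2, r2, p2⟩ := h7.1.rot hy'
  have hp' : L.Perm ((C1 ++ C2) ++ (b1.1 ++ fl m ++ b2.1 ++ fl d)) := by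
    refine List.Perm.trans ?_ ((p1.append p2).append_right _)
    refine hp.trans ?_
    rw [fl_cons, fl_append, fl_cons, ← Multiset.coe_eq_coe]
    simp only [← Multiset.coe_add]
    abel
  refine hI _ _ y u hp' (r1.append r2) (((h1.append h5.wk).append h6).append h9.wk) ?_ hr ?_
  · intro hn
    have : C1 = [] := (List.append_eq_nil_iff.1 hn).1
    subst this
    exact h2.2.1 p1.eq_nil
  · rw [ng_append, ← ng_perm p1, ← ng_perm p2]
    exact h3.add_odd h8

theorem opt_own {L P C : List E} {x : V} {bs : List (List E × V × List E)}
    (hI : Irr ends sgn L) (h : Opt ends sgn L ((P, x, C) :: bs)) :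
    ∀ z ∈ support ends P.toFinset, z ∈ support ends C.toFinset → z = x := by
  intro z hz hz'
  by_contra hne
  obtain ⟨⟨⟨u, h1, h2, h3, h4⟩, hp, -⟩, -⟩ := h
  simp only at h1 h2 h3 h4
  obtain ⟨Q1, Q2, rfl, q1, q2⟩ := h1.touch hz
  obtain ⟨A, B, hA, hB, hC, he⟩ := two_split h2.1 h3 h2.base_mem hz' (ng ends sgn Q2)
  have hp' : L.Perm ((Q2 ++ A) ++ (Q1 ++ B.reverse ++ fl bs)) := by
    have h5 : ((Q2 ++ A) ++ (Q1 ++ B ++ fl bs)).Perm ((Q2 ++ A) ++ (Q1 ++ B.reverse ++ fl bs)) :=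
      (((B.reverse_perm.symm).append_left Q1).append_right _).append_left _
    refine List.Perm.trans ?_ h5
    refine hp.trans ?_
    rw [fl_cons]
    refine ((hC.append_left _).append_right _).trans ?_
    rw [← Multiset.coe_eq_coe]
    simp only [← Multiset.coe_add]
    abel
  refine hI _ _ z u hp' (q2.append hA) ((q1.append hB.rev).append h4.wk) ?_ ?_ ?_
  · simp [wk_ne_nil q2 hne]
  · simp [wk_ne_nil hB (Ne.symm hne)]
  · rw [ng_append]; exact he

theorem opt_prev {L P C P' C' : List E} {x x' : V} {bs : List (List E × V × List E)}
    (hI : Irr ends sgn L) (h : Opt ends sgn L ((P', x', C') :: (P, x, C) :: bs)) :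
    ∀ z ∈ support ends P.toFinset, z ∈ support ends C'.toFinset → z = x' := by
  intro z hz hz'
  by_contra hne
  obtain ⟨⟨⟨u, h1, h2, h3, h4, h5, h6, h7⟩, hp, -⟩, -⟩ := h
  simp only at h1 h2 h3 h4 h5 h6 h7
  obtain ⟨Q1, Q2, rfl, q1, q2⟩ := h4.touch hz
  obtain ⟨A, B, hA, hB, hC, he⟩ := two_split h2.1 h3 h2.base_mem hz' (ng ends sgn Q1)
  have hp' : L.Perm ((Q1 ++ A.reverse) ++ (P' ++ B ++ Q2 ++ C ++ fl bs)) := by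
    refine List.Perm.trans ?_ (((A.reverse_perm.symm).append_left Q1).append_right _)
    refine hp.trans ?_
    rw [fl_cons, fl_cons]
    refine ((hC.append_left _).append_right _).trans ?_
    rw [← Multiset.coe_eq_coe]
    simp only [← Multiset.coe_add]
    abel
  refine hI _ _ x' u hp' (q1.append hA.rev)
    ((((h1.append hB).append q2).append h5.1).append h7.wk) ?_ ?_ ?_
  · simp [wk_ne_nil q1 (Ne.symm hne)]
  · simp [h5.2.1]
  · rw [ng_append, ng_rev]; exact he

theorem pw_le (m : List (List E × V × List E)) : (Pw m).length ≤ (fl m).length := by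
  rw [(fl_split m).length_eq]; simp

theorem pairwise_of_split {α : Type} {R : α → α → Prop} {l : List α}
    (h : ∀ s a m b d, l = s ++ a :: (m ++ b :: d) → R a b) : l.Pairwise R := by
  induction l with
  | nil => simp
  | cons a l ih =>
    rw [List.pairwise_cons]
    constructor
    · intro b hb
      obtain ⟨s, t, rfl⟩ := List.append_of_mem hb
      exact h [] a s b t rfl
    · apply ih
      rintro s c m d t rfl
      exact h (a :: s) c m d t rfl

theorem opt_pair {L : List E} {bs : List (List E × V × List E)}
    (hI : Irr ends sgn L) (h : Opt ends sgn L bs) (hP : Pw bs ≠ []) :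
    bs.Pairwise (fun b b' => ∀ y ∈ support ends b.2.2.toFinset,
      y ∉ support ends b'.2.2.toFinset) := by
  apply pairwise_of_split
  rintro s a m b d rfl
  have h1 := h.rot
  rw [List.cons_append, List.append_assoc, List.cons_append] at h1
  refine opt_disj hI h1 ?_
  intro hn
  apply hP
  have e := congrArg List.length hn
  have p1 := pw_le m
  have p2 := pw_le d
  have p3 := pw_le s
  apply List.length_eq_zero_iff.1
  simp at e ⊢
  simp [e] at p1 p2 p3
  simp [p1, p2, p3, e]

/-! The covering by consecutive barbells -/

def Abar (ends : E → Sym2 V) : (List E × V × List E) → List (List E × V × List E) → List (Finset E)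
  | _, [] => []
  | p, b :: bs => (p.2.2.toFinset ∪ b.2.2.toFinset ∪ b.1.toFinset) :: Abar ends b bs

theorem abar_signed : ∀ (bs : List (List E × V × List E)) (p),
    (∀ a q b d, p :: bs = a ++ q :: b :: d →
      IsSignedCircuit ends sgn (q.2.2.toFinset ∪ b.2.2.toFinset ∪ b.1.toFinset)) →
    ∀ F ∈ Abar ends p bs, IsSignedCircuit ends sgn F := by
  intro bs
  induction bs with
  | nil => intro p _ F hF; simp [Abar] at hF
  | cons b bs ih =>
    intro p h F hF
    rcases List.mem_cons.1 hF with rfl | hF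
    · exact h [] p b bs rfl
    · refine ih b ?_ F hF
      intro a q c d he
      exact h (p :: a) q c d (by simp [he])

theorem abar_len (ℓ : List E × V × List E) : ∀ (bs : List (List E × V × List E)) (p),
    totalLength (Abar ends p (bs ++ [ℓ])) + ℓ.2.2.length ≤
      p.2.2.length + 2 * (Cw (bs ++ [ℓ])).length + (Pw (bs ++ [ℓ])).length := by
  intro bs
  have aux : ∀ p b : List E × V × List E, (p.2.2.toFinset ∪ b.2.2.toFinset ∪ b.1.toFinset).card ≤
      p.2.2.length + b.2.2.length + b.1.length := by
    intro p b
    have h1 := Finset.card_union_le (p.2.2.toFinset ∪ b.2.2.toFinset) b.1.toFinset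
    have h2 := Finset.card_union_le p.2.2.toFinset b.2.2.toFinset
    have := List.toFinset_card_le p.2.2
    have := List.toFinset_card_le b.2.2
    have := List.toFinset_card_le b.1
    omega
  induction bs with
  | nil =>
    intro p
    have := aux p ℓ
    simp only [Abar, totalLength, List.nil_append, List.map_cons, List.sum_cons, List.map_nil,
      List.sum_nil, Cw_cons, Pw_cons, Cw_nil, Pw_nil, List.length_append, List.length_nil]
    omega
  | cons b bs ih =>
    intro p
    have := aux p b
    have := ih b
    simp only [Abar, totalLength, List.cons_append, List.map_cons, List.sum_cons,
      Cw_cons, Pw_cons, List.length_append] at this ⊢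
    omega

theorem abar_cov : ∀ (bs : List (List E × V × List E)) (p), ∀ e ∈ fl bs,
    ∃ F ∈ Abar ends p bs, e ∈ F := by
  intro bs
  induction bs with
  | nil => intro p e he; simp at he
  | cons b bs ih =>
    intro p e he
    rw [fl_cons] at he
    rcases List.mem_append.1 he with h | h
    · refine ⟨_, List.mem_cons_self, ?_⟩
      simp at h ⊢; tauto
    · obtain ⟨F, h1, h2⟩ := ih b e h
      exact ⟨F, List.mem_cons_of_mem _ h1, h2⟩

theorem opt_bar {L : List E} {p b : List E × V × List E} {d : List (List E × V × List E)}
    (hg : Good ends L) (hI : Irr ends sgn L) (h : Opt ends sgn L (p :: b :: d))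
    (hP : Pw (p :: b :: d) ≠ []) :
    IsSignedCircuit ends sgn (p.2.2.toFinset ∪ b.2.2.toFinset ∪ b.1.toFinset) := by
  obtain ⟨⟨u, hs⟩, -, -⟩ := h.1
  obtain ⟨P', x', C'⟩ := p
  obtain ⟨P, x, C⟩ := b
  have hr : Opt ends sgn L ((P, x, C) :: (d ++ [(P', x', C')])) := by
    have := Opt.rot (a := [(P', x', C')]) h
    simpa using this
  have hpw := (List.pairwise_cons.1 (opt_pair hI h hP)).1 (P, x, C) (by simp)
  obtain ⟨h1, h2, h3, h4, h5, h6, h7⟩ := hs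
  refine long_barbell (h2.unb h3) (h5.unb h6) hpw ?_ h2.base_mem h5.base_mem
    (opt_prev hI h) (opt_own hI hr)
  refine opt_smp hg hI hr ?_
  refine ⟨h4, h5, h6, ?_⟩
  exact sys_append.2 ⟨u, h7, h1, h2, h3, rfl⟩

theorem opt_abar {L : List E} {bs : List (List E × V × List E)}
    (hg : Good ends L) (hI : Irr ends sgn L) (h : Opt ends sgn L bs) (hP : Pw bs ≠ []) :
    ∃ A, (∀ F ∈ A, IsSignedCircuit ends sgn F) ∧ (∀ e ∈ fl bs, ∃ F ∈ A, e ∈ F) ∧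
      totalLength A ≤ 2 * (Cw bs).length + (Pw bs).length := by
  obtain ⟨⟨u, hs⟩, -, hne⟩ := h.1
  rcases List.eq_nil_or_concat bs with rfl | ⟨mid, ℓ, rfl⟩
  · exact absurd rfl hne
  rw [List.concat_eq_append] at *
  refine ⟨Abar ends ℓ (mid ++ [ℓ]), ?_, abar_cov _ _, ?_⟩
  · apply abar_signed
    rintro a q b d he
    rcases a with _ | ⟨a0, a⟩
    · simp only [List.nil_append, List.cons.injEq] at he
      obtain ⟨rfl, he⟩ := he
      rcases mid with _ | ⟨b', mid⟩
      · exfalso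
        obtain ⟨P, x, C⟩ := ℓ
        have hS := opt_smp hg hI h hs
        obtain ⟨-, -, -, rfl⟩ := hs
        have := smp_closed hS
        exact hP (by simp [this])
      · simp only [List.cons_append, List.cons.injEq] at he
        obtain ⟨rfl, rfl⟩ := he
        have hr := h.rot
        refine opt_bar hg hI (d := mid) (by simpa using hr) ?_
        intro hn
        apply hP
        simp at hn ⊢; tauto
    · simp only [List.cons_append, List.cons.injEq] at he
      obtain ⟨rfl, he⟩ := he
      rw [he] at h hP
      have hr := h.rot
      refine opt_bar hg hI (d := d ++ a) (by simpa using hr) ?_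
      intro hn
      apply hP
      simp at hn ⊢; tauto
  · have := abar_len (ends := ends) ℓ mid ℓ
    omega

theorem opt_touch {L : List E} {bs : List (List E × V × List E)} {u : V}
    (hs : Sys ends sgn u bs u) (hL : L.Perm (fl bs))
    (hpw : bs.Pairwise (fun b b' => ∀ y ∈ support ends b.2.2.toFinset,
      y ∉ support ends b'.2.2.toFinset)) {c : List E} {x0 : V} (hc : Cyc ends x0 c)
    (hcL : ∀ e ∈ c, e ∈ L) :
    ∃ y ∈ support ends c.toFinset, ∃ W1 W2, Pw bs = W1 ++ W2 ∧
      Wk ends u W1 y ∧ Wk ends y W2 u := by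
  by_cases h : ∃ e ∈ c, e ∈ Pw bs
  · obtain ⟨e, he, heP⟩ := h
    obtain ⟨a, b, hab⟩ := sym2_rep (ends := ends) e
    obtain ⟨W1, W2, h1⟩ := hs.wkP.touch (y := a) (mem_supp.2 ⟨e, heP, by simp [hab]⟩)
    exact ⟨a, mem_supp.2 ⟨e, he, by simp [hab]⟩, W1, W2, h1⟩
  push Not at h
  have hCw : ∀ e ∈ c, ∃ b ∈ bs, e ∈ b.2.2 := by
    intro e he
    have h1 := (hL.trans (fl_split bs)).mem_iff.1 (hcL e he)
    rcases List.mem_append.1 h1 with h2 | h2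
    · exact absurd h2 (h e he)
    · simp only [Cw, List.mem_flatten, List.mem_map] at h2
      obtain ⟨l, ⟨b, hb, rfl⟩, h3⟩ := h2
      exact ⟨b, hb, h3⟩
  obtain ⟨e, he⟩ := List.exists_mem_of_ne_nil c hc.2.1
  obtain ⟨⟨P, x, C⟩, hb, heC⟩ := hCw e he
  simp only at heC
  have hloc : ∀ w ∈ support ends C.toFinset, ∀ g ∈ c, w ∈ ends g → g ∈ C := by
    intro w hw g hg hwg
    obtain ⟨b', hb', hg'⟩ := hCw g hg
    by_cases heq : (P, x, C) = b'
    · subst heq; exact hg'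
    · exfalso
      have hsym : bs.Pairwise (fun b b' => Disjoint (support ends b.2.2.toFinset)
          (support ends b'.2.2.toFinset)) :=
        hpw.imp (fun h => Finset.disjoint_left.2 (fun y hy => h y hy))
      have : Std.Symm (fun b b' : List E × V × List E => Disjoint (support ends b.2.2.toFinset)
          (support ends b'.2.2.toFinset)) := ⟨fun _ _ h => Disjoint.symm h⟩
      have := hsym.forall hb hb' heq
      exact Finset.disjoint_left.1 this hw (mem_supp.2 ⟨g, hg', hwg⟩)
  obtain ⟨s, t, hst⟩ := List.append_of_mem hb
  subst hst
  obtain ⟨y, s1, s2, s3, s4, s5⟩ := sys_append.1 hs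
  simp only at s2 s3 s4 s5
  refine ⟨x, ?_, Pw s ++ P, Pw t, by simp, s1.wkP.append s2, s5.wkP⟩
  obtain ⟨a, b, hab⟩ := sym2_rep (ends := ends) e
  have ha : a ∈ support ends C.toFinset := mem_supp.2 ⟨e, heC, by simp [hab]⟩
  have hR := s3.2.2.2.2.1 a ha x s3.base_mem
  have : x ∈ support ends c.toFinset ∧ x ∈ support ends C.toFinset := by
    have hdC := s3.2.2.2.2.2
    have hdc := hc.2.2.2.2.2
    clear s2 s3 s4 s5 hb hpw hs hL h hCw
    induction hR with
    | refl => exact ⟨mem_supp.2 ⟨e, he, by simp [hab]⟩, ha⟩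
    | @tail w w' _ hf ih =>
      obtain ⟨hw1, hw2⟩ := ih
      obtain ⟨f, hfC, hf⟩ := hf
      have hfC' : f ∈ C := by simpa using hfC
      refine ⟨mem_supp.2 ⟨f, ?_, by simp [hf]⟩, mem_supp.2 ⟨f, hfC', by simp [hf]⟩⟩
      by_contra hfc
      have d1 := hdc w hw1
      have d2 := hdC w hw2
      rw [degree_eq] at d1 d2
      rw [← Finset.sum_filter_add_sum_filter_not c.toFinset (fun g => w ∈ ends g)] at d1
      have z0 : ∑ g ∈ c.toFinset with ¬ w ∈ ends g, ct ends g w = 0 :=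
        Finset.sum_eq_zero (fun g hg => ct_eq_zero.2 (Finset.mem_filter.1 hg).2)
      rw [← Finset.add_sum_erase _ _ hfC] at d2
      have hsub : (c.toFinset.filter (fun g => w ∈ ends g)) ⊆ C.toFinset.erase f := by
        intro g hg
        obtain ⟨g1, g2⟩ := Finset.mem_filter.1 hg
        have g1' : g ∈ c := by simpa using g1
        refine Finset.mem_erase.2 ⟨?_, by simpa using hloc w hw2 g g1' g2⟩
        rintro rfl
        exact hfc g1'
      have hle := Finset.sum_le_sum_of_subset (f := fun g => ct ends g w) hsub
      have hpos : ct ends f w ≠ 0 := fun h0 => ct_eq_zero.1 h0 (by simp [hf])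
      omega
  exact this.1

end sys

section final
variable {ends : E → Sym2 V} {sgn : E → Bool}

theorem opt_cov_pos {L : List E} {x : V} {bs : List (List E × V × List E)}
    (hw : Wk ends x L x) (hg : Good ends L) (he : Even (ng ends sgn L)) (hI : Irr ends sgn L)
    (h : Opt ends sgn L bs) (hP : Pw bs ≠ []) : Cov ends sgn L := by
  obtain ⟨⟨u, hs⟩, hL, -⟩ := h.1
  obtain ⟨A, a1, a2, a3⟩ := opt_abar hg hI h hP
  obtain ⟨D, hD, hR⟩ := dec_best (sgn := sgn) hw hg
  obtain ⟨B, B', b1, b1', b2, b2', b3⟩ := pcover (W := Pw bs) (u := u) he hD hR (by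
    intro c hc _
    obtain ⟨y, hy⟩ := hD.1 c hc
    refine opt_touch hs hL (opt_pair hI h hP) hy ?_
    intro e hec
    have : e ∈ D.flatten := List.mem_flatten.2 ⟨c, hc, hec⟩
    exact (List.mem_filter.1 (hD.2.mem_iff.2 this)).1)
  have cv : ∀ X : List (Finset E), (∀ c ∈ D, ∃ F ∈ X, c.toFinset ⊆ F) →
      ∀ e ∈ L, e ∈ nonbridges ends → ∃ F ∈ X, e ∈ F := by
    intro X hX e heL heN
    have : e ∈ D.flatten := hD.2.mem_iff.1 (List.mem_filter.2 ⟨heL, by simpa using heN⟩)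
    obtain ⟨c, hc, hec⟩ := List.mem_flatten.1 this
    obtain ⟨F, h1, h2⟩ := hX c hc
    exact ⟨F, h1, h2 (by simpa using hec)⟩
  have hn : D.flatten.length = nN ends L := by
    rw [← hD.2.length_eq, nN, List.countP_eq_length_filter]
  have hl : L.length = (Pw bs).length + (Cw bs).length := by
    rw [(hL.trans (fl_split bs)).length_eq, List.length_append]
  by_cases c1 : 3 * totalLength A ≤ 2 * (L.length + nN ends L)
  · exact ⟨A, a1, fun e heL _ => a2 e (hL.mem_iff.1 heL), c1⟩
  by_cases c2 : 3 * totalLength B ≤ 2 * (L.length + nN ends L)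
  · exact ⟨B, b1, cv B b2, c2⟩
  exact ⟨B', b1', cv B' b2', by omega⟩

theorem opt_cov_zero {L : List E} {bs : List (List E × V × List E)}
    (hg : Good ends L) (he : Even (ng ends sgn L)) (hI : Irr ends sgn L)
    (h : Opt ends sgn L bs) (hP : Pw bs = []) : Cov ends sgn L := by
  obtain ⟨⟨u, hs⟩, hL, hne⟩ := h.1
  match bs, hne with
  | [b], _ =>
    exfalso
    simp at hP
    simp [hP] at hL
    obtain ⟨-, -, h3, -⟩ := hs
    rw [ng_perm hL] at he
    exact Nat.not_even_iff_odd.2 h3 he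
  | (P, x, C) :: (P', x', C') :: r, _ =>
    simp only [Pw_cons, List.append_eq_nil_iff] at hP
    obtain ⟨rfl, rfl, hr⟩ := hP
    obtain ⟨h1, h2, h3, h4, h5, h6, h7⟩ := hs
    simp only at h1 h2 h3 h4 h5 h6 h7
    have h4 : x = x' := h4
    subst h4
    rcases r with _ | ⟨b, r⟩
    · simp at hL
      by_cases hz : ∃ z ∈ support ends C.toFinset, z ∈ support ends C'.toFinset ∧ x ≠ z
      · exfalso
        obtain ⟨z, z1, z2, z3⟩ := hz
        obtain ⟨L1, L2, w1, w2, n1, n2, e1, e2, hp⟩ :=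
          theta h2.1 h5.1 h3 h6 z3 h2.base_mem z1 h5.base_mem z2
        exact hI L1 L2 x x (hL.trans hp) w1 w2 n1 n2 e1
      · push Not at hz
        have hS : IsSignedCircuit ends sgn (C.toFinset ∪ C'.toFinset) :=
          short_barbell (h2.unb h3) (h5.unb h6)
            (fun e he he' => (hg.perm hL).disj (h2.mem_nb he) he he') h2.base_mem h5.base_mem
            (fun y hy hy' => (hz y hy hy').symm)
        refine ⟨[C.toFinset ∪ C'.toFinset], by simpa using hS, ?_, ?_⟩
        · intro e heL _
          have := hL.mem_iff.1 heL
          exact ⟨_, List.mem_singleton.2 rfl, by simpa using this⟩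
        · have q1 := Finset.card_union_le C.toFinset C'.toFinset
          have q2 := List.toFinset_card_le C
          have q3 := List.toFinset_card_le C'
          rw [nN_perm hL, nN_append, h2.nN_eq, h5.nN_eq, hL.length_eq, List.length_append]
          simp only [totalLength, List.map_cons, List.map_nil, List.sum_cons, List.sum_nil]
          omega
    · exfalso
      obtain ⟨-, g2, -⟩ := h7
      refine opt_disj (m := []) (d := b :: r) hI h ?_ x h2.base_mem h5.base_mem
      simp [g2.2.1]

theorem main_claim : MainClaim ends sgn := by
  intro L
  induction hn : L.length using Nat.strong_induction_on generalizing L with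
  | _ n ih =>
  intro x hw hg he
  by_contra hcov
  have hI : Irr ends sgn L := by
    intro L1 L2 a b hp w1 w2 n1 n2 e1
    apply hcov
    have hl := hp.length_eq
    rw [List.length_append] at hl
    have p1 := List.length_pos_iff.2 n1
    have p2 := List.length_pos_iff.2 n2
    have e2 : Even (ng ends sgn L2) := by
      rw [ng_perm hp, ng_append] at he
      exact (Nat.even_add.1 he).1 e1
    have hg' := hg.perm hp
    exact Cov.add hp (ih L1.length (by omega) L1 rfl a w1 hg'.left e1)
      (ih L2.length (by omega) L2 rfl b w2 hg'.right e2)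
  have hL : L ≠ [] := by
    rintro rfl; exact hcov Cov.nil
  have hfeas : ∃ bs, Feas ends sgn L bs := by
    obtain ⟨L1, L2, L3, y, hLe, h1, h3, h2, hne, hc⟩ :=
      extract hw (fun h => hL (smp_closed h))
    have hp : L.Perm (L2 ++ (L3 ++ L1)) := by
      rw [hLe, ← Multiset.coe_eq_coe]
      simp only [← Multiset.coe_add]
      abel
    by_cases hr : L3 ++ L1 = []
    · exfalso
      rw [hr, List.append_nil] at hp
      rcases hc with hc | ⟨e, rfl⟩
      · apply hcov
        refine Cov.add (L2 := []) (by simpa using hp) (hc.cov ?_) Cov.nil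
        rwa [← ng_perm hp]
      · have hb := back_not_mem (hg.perm hp)
        refine hcov ⟨[], by simp, ?_, by simp [totalLength]⟩
        intro f hf hfn
        have := hp.mem_iff.1 hf
        simp at this
        subst this
        exact absurd hfn hb
    · have hodd := hI L2 _ y y hp h2 (h3.append h1) hne hr
      rcases hc with hc | ⟨e, rfl⟩
      · refine ⟨[(L3 ++ L1, y, L2)], ⟨y, h3.append h1, hc, Nat.not_even_iff_odd.1 hodd, rfl⟩, ?_,
          by simp⟩
        refine hp.trans ?_
        simp only [fl_cons, fl_nil, List.append_nil]
        exact List.perm_append_comm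
      · have := back_not_mem (hg.perm hp).left
        exact absurd (by simp [ng, this]) hodd
  have hopt : ∃ bs, Opt ends sgn L bs := by
    have hex : ∃ k, ∃ bs, Feas ends sgn L bs ∧ (Pw bs).length = k := by
      obtain ⟨bs, hb⟩ := hfeas
      exact ⟨_, bs, hb, rfl⟩
    obtain ⟨bs, hb, hk⟩ := Nat.find_spec hex
    refine ⟨bs, hb, fun bs' hb' => ?_⟩
    rw [hk]
    exact Nat.find_min' hex ⟨bs', hb', rfl⟩
  obtain ⟨bs, hb⟩ := hopt
  by_cases hP : Pw bs = []
  · exact hcov (opt_cov_zero hg he hI hb hP)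
  · exact hcov (opt_cov_pos hw hg he hI hb hP)

end final

/-- A tree of Eulerian graphs with an even number of negative
non-bridge edges has a weak signed circuit cover of length at most 4/3·|E(H)|. -/
theorem statement7 {V E : Type} [Fintype V] [Fintype E] [DecidableEq V] [DecidableEq E]
    (ends : E → Sym2 V) (sgn : E → Bool)
    (hte : IsTreeOfEulerian ends)
    (heven : Even (negEdges sgn (nonbridges ends)).card) :
    ∃ 𝒞 : List (Finset E),
      (∀ C ∈ 𝒞, IsSignedCircuit ends sgn C) ∧
      (∀ e : E, ¬ IsBridgeIn ends Finset.univ e → ∃ C ∈ 𝒞, e ∈ C) ∧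
      3 * totalLength 𝒞 ≤ 4 * Fintype.card E := by
  exact top_reduction hte heven main_claim

end SignedCircuitCover
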